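/- arXiv:1904.08246 — 4 statements merged into one kernel-verified Lean document; each statement's English description precedes it below -/
import Mathlib

section
/- Let $S=\{p_1,\ldots,p_n\}\subset\mathbb{R}^d$ be a finite set of points and let $S_1,\ldots,S_k$ be a partition of $S$. Then there exists a compact set $\widetilde K\subset\mathbb{R}^d$ which is a competitor for the partitioned Steiner tree problem and which has minimal $\mathcal{H}^1$-measure, i.e. $\mathcal{H}^1(\widetilde K)\le\mathcal{H}^1(K)$ for every compact set $K$ which is a competitor for the partitioned Steiner tree problem. -/
open MeasureTheory

/-- A compact set `K ⊆ ℝ^d` is a competitor for the partitioned Steiner tree problem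
associated to the points `p 1, …, p n` and the partition `P 1, …, P k` of the set
`S = {p 1, …, p n}` if `K` is compact, contains `S`, and for every `i` all points of
`P i` lie in the same connected component of `K`. -/
def IsPartSteinerCompetitor {d n k : ℕ} (p : Fin n → EuclideanSpace ℝ (Fin d))
    (P : Fin k → Set (EuclideanSpace ℝ (Fin d))) (K : Set (EuclideanSpace ℝ (Fin d))) : Prop :=
  IsCompact K ∧ Set.range p ⊆ K ∧
    ∀ i : Fin k, ∀ x ∈ P i, ∀ y ∈ P i, connectedComponentIn K x = connectedComponentIn K y

section NetworkLength

variable {V : Type*} [Fintype V]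

open Classical in
/-- The total length of the straight-line drawing of a graph with vertices at the points `f v`. -/
noncomputable def networkLength {X : Type*} [PseudoMetricSpace X] (H : SimpleGraph V)
    (f : V → X) : ℝ :=
  ∑ e ∈ H.edgeFinset, Sym2.lift ⟨fun a b => dist (f a) (f b), fun _ _ => dist_comm _ _⟩ e

theorem networkLength_eq {X : Type*} [PseudoMetricSpace X] (H : SimpleGraph V)
    [DecidableRel H.Adj] (f : V → X) :
    networkLength H f = ∑ e ∈ H.edgeFinset,
      Sym2.lift ⟨fun a b => dist (f a) (f b), fun _ _ => dist_comm _ _⟩ e := by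
  unfold networkLength
  congr!

theorem networkLength_congr {X : Type*} [PseudoMetricSpace X] {H : SimpleGraph V}
    {f g : V → X} (h : ∀ v ∈ H.support, f v = g v) : networkLength H f = networkLength H g := by
  classical
  refine Finset.sum_congr rfl fun e he => ?_
  induction e with | _ a b =>
  have hab : H.Adj a b := by simpa using he
  simp only [Sym2.lift_mk, h a ⟨b, hab⟩, h b ⟨a, hab.symm⟩]

theorem networkLength_map_le {V' X : Type*} [Fintype V'] [PseudoMetricSpace X]
    (H : SimpleGraph V) (g : V → V') (f : V' → X) :
    networkLength (H.map g) f ≤ networkLength H (f ∘ g) := by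
  classical
  let F : Sym2 V' → ℝ := Sym2.lift ⟨fun a b => dist (f a) (f b), fun _ _ => dist_comm _ _⟩
  have hF : ∀ e, 0 ≤ F e := fun e => by
    induction e with | _ a b => exact dist_nonneg
  have hsub : (H.map g).edgeFinset ⊆ H.edgeFinset.image (Sym2.map g) := by
    intro e he
    induction e with | _ a b =>
    obtain ⟨-, u, v, huv, rfl, rfl⟩ : (H.map g).Adj a b := by simpa using he
    exact Finset.mem_image.2 ⟨s(u, v), by simpa using huv, by simp⟩
  rw [networkLength_eq, networkLength_eq]
  calc ∑ e ∈ (H.map g).edgeFinset, F e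
      ≤ ∑ e ∈ H.edgeFinset.image (Sym2.map g), F e :=
        Finset.sum_le_sum_of_subset_of_nonneg hsub fun e _ _ => hF e
    _ ≤ ∑ e ∈ H.edgeFinset, F (Sym2.map g e) :=
        Finset.sum_image_le_of_nonneg fun e _ => hF e
    _ = _ := Finset.sum_congr rfl fun e _ => by
        induction e with | _ a b => rfl

theorem continuous_networkLength {X : Type*} [PseudoMetricSpace X] (H : SimpleGraph V) :
    Continuous (networkLength (X := X) H) := by
  refine continuous_finsetSum _ fun e _ => ?_
  induction e with | _ a b =>
  simp only [Sym2.lift_mk]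
  fun_prop

end NetworkLength

namespace SimpleGraph

variable {V V' : Type*} {G : SimpleGraph V}

/-- A map sending adjacent vertices to reachable ones sends reachable vertices to reachable
ones. -/
theorem Reachable.map_of_adj {H : SimpleGraph V'} (φ : V → V')
    (h : ∀ x y, G.Adj x y → H.Reachable (φ x) (φ y)) {x y : V} (hxy : G.Reachable x y) :
    H.Reachable (φ x) (φ y) := by
  obtain ⟨p⟩ := hxy
  induction p with
  | nil => exact Reachable.refl _
  | cons hadj _ ih => exact (h _ _ hadj).trans ih

/-- Removing a vertex preserves reachability between the other vertices as soon as the neighbors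
of the removed vertex stay reachable from each other. -/
theorem Reachable.of_deleteIncidenceSet_le {H : SimpleGraph V} {u : V}
    (hle : G.deleteIncidenceSet u ≤ H)
    (hN : ∀ a b, G.Adj u a → G.Adj u b → H.Reachable a b) {x y : V} (hx : x ≠ u) (hy : y ≠ u)
    (hxy : G.Reachable x y) : H.Reachable x y := by
  classical
  let φ : V → V := fun v => if v = u then (if h : ∃ a, G.Adj u a then h.choose else u) else v
  have hφ : ∀ v, v ≠ u → φ v = v := fun v hv => if_neg hv
  have hφu : ∀ b, G.Adj u b → H.Reachable (φ u) b := by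
    intro b hb
    have h : ∃ a, G.Adj u a := ⟨b, hb⟩
    have : φ u = h.choose := by simp only [φ, if_true, dif_pos h]
    rw [this]
    exact hN _ _ h.choose_spec hb
  have := hxy.map_of_adj (H := H) φ fun a b hab => by
    by_cases ha : a = u
    · subst ha
      rw [hφ b hab.ne']
      exact hφu b hab
    · by_cases hb : b = u
      · subst hb
        rw [hφ a ha]
        exact (hφu a hab.symm).symm
      · rw [hφ a ha, hφ b hb]
        exact (hle (deleteIncidenceSet_adj.2 ⟨hab, ha, hb⟩)).reachable
  rwa [hφ x hx, hφ y hy] at this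

/-- A forest has at most as many edges as vertices. -/
theorem IsAcyclic.card_edgeFinset_le [Fintype V] [Fintype G.edgeSet] (hG : G.IsAcyclic) :
    G.edgeFinset.card ≤ Fintype.card V := by
  classical
  rcases isEmpty_or_nonempty V with hV | hV
  · have : G.edgeFinset = ∅ := by
      ext e
      induction e with | _ a b => exact hV.elim a
    simp [this]
  obtain ⟨T, hGT, -, hT⟩ :=
    (connected_top (V := V)).exists_isTree_le_of_le_of_isAcyclic le_top hG
  have h₁ := hT.card_edgeFinset
  have h₂ : G.edgeFinset.card ≤ T.edgeFinset.card := Finset.card_le_card (edgeFinset_mono hGT)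
  omega

theorem IsAcyclic.card_edgeFinset_le_of_support_subset [Fintype V] [DecidableEq V]
    [DecidableRel G.Adj] (hG : G.IsAcyclic) {A : Finset V} (hA : G.support ⊆ A) :
    G.edgeFinset.card ≤ A.card := by
  have h := (hG.induce (A : Set V)).card_edgeFinset_le
  have h' := card_edgeFinset_induce_of_support_subset hA
  simp only [SetLike.coe_sort_coe, edgeFinset_card, ← Nat.card_eq_fintype_card,
    Nat.card_eq_finsetCard] at h h' ⊢
  omega

/-- A forest on `A` all of whose vertices outside `T` have degree at least three has at most
`3 * #T` vertices. -/
theorem IsAcyclic.card_le_of_three_le_degree [Fintype V] [DecidableEq V]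
    [DecidableRel G.Adj] (hG : G.IsAcyclic) {A T : Finset V} (hA : G.support ⊆ A)
    (hTA : T ⊆ A) (hdeg : ∀ u ∈ A, u ∉ T → 3 ≤ G.degree u) : A.card ≤ 3 * T.card := by
  have h₁ := hG.card_edgeFinset_le_of_support_subset hA
  have h₂ := G.sum_degrees_eq_twice_card_edges
  have h₃ : ∑ v ∈ A \ T, G.degree v ≤ ∑ v, G.degree v :=
    Finset.sum_le_sum_of_subset (Finset.subset_univ _)
  have h₄ : (A \ T).card * 3 ≤ ∑ v ∈ A \ T, G.degree v := by
    rw [← smul_eq_mul]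
    refine Finset.card_nsmul_le_sum _ _ _ fun v hv => ?_
    exact hdeg v (Finset.mem_sdiff.1 hv).1 (Finset.mem_sdiff.1 hv).2
  have h₅ := Finset.card_sdiff_add_card_eq_card hTA
  omega

/-- Consider a finite network whose vertices `v` are sets `U v` of diameter at most `w v` and whose
edges `s(a, b)` bridge gaps of length at most `c s(a, b)` between `U a` and `U b`. One can suppress
all but boundedly many vertices, without disconnecting the terminals `T`, and replace the others by
points `z v ∈ U v`, so that the length of the network is essentially at most its total weight. -/
theorem exists_sparse_network {X : Type*} [PseudoMetricSpace X] [Fintype V] [DecidableEq V]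
    (U : V → Set X) (z : V → X) (hz : ∀ v, (U v).Nonempty → z v ∈ U v) (w : V → ℝ)
    (hw : ∀ v, 0 ≤ w v) (hU : ∀ v, ∀ x ∈ U v, ∀ y ∈ U v, Dist.dist x y ≤ w v)
    {δ : ℝ} (hδ : ∀ v, w v ≤ δ) (T : Finset V)
    {W : ℝ} (A : Finset V) (G : SimpleGraph V) [DecidableRel G.Adj] (c : Sym2 V → ℝ)
    (hTA : T ⊆ A) (hGA : G.support ⊆ A) (hc : ∀ e, 0 ≤ c e)
    (hdist : ∀ a b, G.Adj a b → ∃ x ∈ U a, ∃ y ∈ U b, Dist.dist x y ≤ c s(a, b))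
    (hW : ∑ e ∈ G.edgeFinset, c e + ∑ v ∈ A, w v ≤ W) :
    ∃ (B : Finset V) (H : SimpleGraph V), T ⊆ B ∧ H.support ⊆ B ∧
      B.card ≤ 3 * T.card ∧
      (∀ x ∈ T, ∀ y ∈ T, G.Reachable x y → H.Reachable x y) ∧
      networkLength H z ≤ W + 6 * T.card * δ := by
  classical
  induction hn : A.card using Nat.strong_induction_on generalizing A G c with
  | _ n ih =>
  obtain ⟨F, hFG, hF, hreach⟩ := G.exists_isAcyclic_reachable_eq_le
  have hFA : F.support ⊆ A := (support_mono hFG).trans hGA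
  have hFdist := fun a b hab => hdist a b (hFG hab)
  have hFW : ∑ e ∈ F.edgeFinset, c e + ∑ v ∈ A, w v ≤ W := by
    refine le_trans ?_ hW
    gcongr
    exact fun _ _ _ => hc _
  by_cases hdeg : ∀ u ∈ A, u ∉ T → 3 ≤ F.degree u
  · have hcard := hF.card_le_of_three_le_degree hFA hTA hdeg
    refine ⟨A, F, hTA, hFA, hcard,
      fun x _ y _ h => by rwa [hreach], ?_⟩
    have hE : (F.edgeFinset.card : ℝ) ≤ 3 * T.card := by
      exact_mod_cast (hF.card_edgeFinset_le_of_support_subset hFA).trans hcard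
    rw [networkLength_eq]
    rcases T.eq_empty_or_nonempty with rfl | ⟨t, -⟩
    · have hE' : F.edgeFinset = ∅ := by
        rw [← Finset.card_eq_zero]
        have := (hF.card_edgeFinset_le_of_support_subset hFA).trans hcard
        simpa using this
      have hA' : A = ∅ := by simpa using hcard
      simpa [hE', hA'] using hFW
    have hδ0 : 0 ≤ δ := (hw t).trans (hδ t)
    calc _ ≤ ∑ e ∈ F.edgeFinset, (c e + 2 * δ) := by
          refine Finset.sum_le_sum fun e he => ?_
          induction e with | _ a b =>
          obtain ⟨x, hx, y, hy, hxy⟩ := hFdist a b (by simpa using he)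
          have h₃ := hU a _ (hz a ⟨x, hx⟩) x hx
          have h₄ := hU b y hy _ (hz b ⟨y, hy⟩)
          have h₅ := dist_triangle4 (z a) x y (z b)
          have h₁ := hδ a
          have h₂ := hδ b
          simp only [Sym2.lift_mk]
          linarith
      _ = ∑ e ∈ F.edgeFinset, c e + F.edgeFinset.card * (2 * δ) := by
          rw [Finset.sum_add_distrib, Finset.sum_const, nsmul_eq_mul]
      _ ≤ W + 3 * T.card * (2 * δ) := by
          have : 0 ≤ ∑ v ∈ A, w v := Finset.sum_nonneg fun v _ => hw v
          gcongr
          linarith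
      _ = _ := by ring
  push Not at hdeg
  obtain ⟨u, huA, huT, hu⟩ := hdeg
  have hlt : (A.erase u).card < n := hn ▸ Finset.card_erase_lt_of_mem huA
  have hTA' : T ⊆ A.erase u := fun t ht =>
    Finset.mem_erase.2 ⟨fun h => huT (h ▸ ht), hTA ht⟩
  have hwA : ∑ v ∈ A.erase u, w v + w u = ∑ v ∈ A, w v := Finset.sum_erase_add _ _ huA
  have hsupp : (F.deleteIncidenceSet u).support ⊆ (A.erase u : Finset V) := by
    rintro x ⟨y, hxy⟩
    obtain ⟨h, hx, -⟩ := deleteIncidenceSet_adj.1 hxy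
    exact Finset.mem_coe.2 (Finset.mem_erase.2 ⟨hx, hFA ⟨y, h⟩⟩)
  have hneT : ∀ t ∈ T, t ≠ u := fun t ht h => huT (h ▸ ht)
  by_cases hN : ∀ a b, F.Adj u a → F.Adj u b → a = b ∨ F.Adj a b
  · obtain ⟨B, H, hTB, hHB, hB, hHr, hHW⟩ := ih _ hlt (A.erase u) (F.deleteIncidenceSet u) c
      hTA' hsupp hc (fun a b hab => hFdist a b (deleteIncidenceSet_le _ _ hab))
      (by
        have : ∑ e ∈ (F.deleteIncidenceSet u).edgeFinset, c e ≤ ∑ e ∈ F.edgeFinset, c e :=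
          Finset.sum_le_sum_of_subset_of_nonneg
            (edgeFinset_mono (deleteIncidenceSet_le F u)) fun _ _ _ => hc _
        have := hw u
        linarith) rfl
    refine ⟨B, H, hTB, hHB, hB, fun x hx y hy hxy => hHr x hx y hy ?_, hHW⟩
    rw [← hreach] at hxy
    refine hxy.of_deleteIncidenceSet_le le_rfl (fun a b ha hb => ?_) (hneT x hx) (hneT y hy)
    rcases hN a b ha hb with rfl | hab
    · exact Reachable.refl _
    · exact (deleteIncidenceSet_adj.2 ⟨hab, ha.ne', hb.ne'⟩ :
        (F.deleteIncidenceSet u).Adj a b).reachable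
  push Not at hN
  obtain ⟨a, b, ha, hb, hab, hnadj⟩ := hN
  have hNu : ∀ x, F.Adj u x → x = a ∨ x = b := by
    intro x hx
    by_contra! hne
    have : ({a, b, x} : Finset V) ⊆ F.neighborFinset u := by
      intro y hy
      simp only [Finset.mem_insert, Finset.mem_singleton] at hy
      rw [mem_neighborFinset]
      rcases hy with rfl | rfl | rfl <;> assumption
    have := Finset.card_le_card this
    rw [Finset.card_eq_three.2 ⟨a, b, x, hab, hne.1.symm, hne.2.symm, rfl⟩,
      card_neighborFinset_eq_degree] at this
    omega
  set D := F.deleteIncidenceSet u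
  have hDF : D ≤ F := deleteIncidenceSet_le F u
  have hDab : ¬ D.Adj a b := fun h => hnadj (hDF h)
  have hnotmem : s(a, b) ∉ D.edgeFinset := by simpa using hDab
  set c' := Function.update c s(a, b) (c s(u, a) + w u + c s(u, b)) with hc'
  have hadj : ∀ x y, (D ⊔ edge a b).Adj x y → D.Adj x y ∨ s(x, y) = s(a, b) := by
    intro x y h
    rw [sup_adj, edge_adj] at h
    rcases h with h | ⟨h, -⟩
    · exact Or.inl h
    · exact Or.inr (by rcases h with ⟨rfl, rfl⟩ | ⟨rfl, rfl⟩ <;> simp [Sym2.eq_swap])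
  have hadj' : (D ⊔ edge a b).Adj a b := by
    rw [sup_adj, edge_adj]
    exact Or.inr ⟨Or.inl ⟨rfl, rfl⟩, hab⟩
  obtain ⟨B, H, hTB, hHB, hB, hHr, hHW⟩ := ih _ hlt (A.erase u) (D ⊔ edge a b) c' hTA'
    (by
      rintro x ⟨y, hxy⟩
      rcases hadj x y hxy with h | h
      · exact hsupp ⟨y, h⟩
      · refine Finset.mem_coe.2 (Finset.mem_erase.2 ?_)
        rcases Sym2.eq_iff.1 h with ⟨rfl, rfl⟩ | ⟨rfl, rfl⟩
        · exact ⟨ha.ne', hFA ⟨u, ha.symm⟩⟩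
        · exact ⟨hb.ne', hFA ⟨u, hb.symm⟩⟩)
    (fun e => by
      by_cases he : e = s(a, b)
      · subst he
        have h₁ := hc s(u, a)
        have h₂ := hc s(u, b)
        have h₃ := hw u
        simp only [hc', Function.update_self]
        linarith
      · simpa only [hc', Function.update_of_ne he] using hc e)
    (by
      have key : ∃ x ∈ U a, ∃ y ∈ U b, Dist.dist x y ≤ c s(u, a) + w u + c s(u, b) := by
        obtain ⟨x₁, hx₁, x, hx, h₁⟩ := hFdist u a ha
        obtain ⟨y₁, hy₁, y, hy, h₂⟩ := hFdist u b hb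
        refine ⟨x, hx, y, hy, (dist_triangle4 x x₁ y₁ y).trans ?_⟩
        rw [_root_.dist_comm x x₁]
        have := hU u x₁ hx₁ y₁ hy₁
        linarith
      intro x y hxy
      by_cases he : s(x, y) = s(a, b)
      · simp only [hc', he, Function.update_self]
        rcases Sym2.eq_iff.1 he with ⟨rfl, rfl⟩ | ⟨rfl, rfl⟩
        · exact key
        · obtain ⟨x₁, h₁, y₁, h₂, h⟩ := key
          exact ⟨y₁, h₂, x₁, h₁, _root_.dist_comm x₁ y₁ ▸ h⟩
      · simp only [hc', Function.update_of_ne he]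
        exact hFdist x y (hDF ((hadj x y hxy).resolve_right he)))
    (by
      have hE : ∀ _ : Fintype (D ⊔ edge a b).edgeSet,
          (D ⊔ edge a b).edgeFinset = insert s(a, b) D.edgeFinset := by
        intro _
        ext e
        induction e with | _ x y =>
        simp only [mem_edgeFinset, mem_edgeSet, Finset.mem_insert]
        constructor
        · exact fun h => (hadj x y h).symm
        · rintro (h | h)
          · rw [← mem_edgeSet, h]
            exact hadj'
          · exact Or.inl h
      rw [hE, Finset.sum_insert hnotmem]
      have h₁ : ∑ e ∈ D.edgeFinset, c' e = ∑ e ∈ D.edgeFinset, c e :=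
        Finset.sum_congr rfl fun e he => by
          rw [hc', Function.update_of_ne (ne_of_mem_of_not_mem he hnotmem)]
      have hua : s(u, a) ∉ insert s(u, b) D.edgeFinset := by
        simp only [Finset.mem_insert, mem_edgeFinset, mem_edgeSet, not_or]
        refine ⟨fun h => hab (Sym2.congr_right.1 h), fun h => ?_⟩
        exact (deleteIncidenceSet_adj.1 h).2.1 rfl
      have hub : s(u, b) ∉ D.edgeFinset := by
        simp only [mem_edgeFinset, mem_edgeSet]
        exact fun h => (deleteIncidenceSet_adj.1 h).2.1 rfl
      have h₂ : ∑ e ∈ insert s(u, a) (insert s(u, b) D.edgeFinset), c e ≤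
          ∑ e ∈ F.edgeFinset, c e := by
        refine Finset.sum_le_sum_of_subset_of_nonneg ?_ fun _ _ _ => hc _
        intro e he
        simp only [Finset.mem_insert] at he
        rcases he with rfl | rfl | he
        · simpa using ha
        · simpa using hb
        · exact edgeFinset_mono hDF he
      rw [Finset.sum_insert hua, Finset.sum_insert hub] at h₂
      rw [h₁, hc', Function.update_self]
      linarith) rfl
  refine ⟨B, H, hTB, hHB, hB, fun x hx y hy hxy => hHr x hx y hy ?_, hHW⟩
  rw [← hreach] at hxy
  refine hxy.of_deleteIncidenceSet_le le_sup_left (fun x y hx hy => ?_) (hneT x hx) (hneT y hy)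
  rcases hNu x hx with rfl | rfl <;> rcases hNu y hy with rfl | rfl
  · exact Reachable.refl _
  · exact hadj'.reachable
  · exact hadj'.symm.reachable
  · exact Reachable.refl _

end SimpleGraph

section Cover

open scoped ENNReal NNReal

theorem Metric.exists_isOpen_superset_ediam_le {X : Type*} [PseudoEMetricSpace X] (s : Set X)
    {η : ℝ≥0} (hη : 0 < η) :
    ∃ u, IsOpen u ∧ s ⊆ u ∧ Metric.ediam u ≤ Metric.ediam s + η := by
  refine ⟨Metric.thickening (η / 2 : ℝ≥0) s, Metric.isOpen_thickening,
    Metric.self_subset_thickening (by positivity) s,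
    (Metric.ediam_thickening_le _).trans_eq ?_⟩
  congr 1
  norm_cast
  exact mul_div_cancel₀ _ two_ne_zero

/-- A compact set of finite one-dimensional Hausdorff measure has finite open covers by small sets
whose total diameter is almost the measure of the set. -/
theorem IsCompact.exists_open_cover_sum_ediam_le {X : Type*} [EMetricSpace X]
    [MeasurableSpace X] [BorelSpace X] {K : Set X}
    (hK : IsCompact K) (hfin : μH[1] K ≠ ∞) {δ ε : ℝ≥0} (hδ : 0 < δ) (hε : 0 < ε) :
    ∃ (t : Finset ℕ) (U : ℕ → Set X), (∀ i, IsOpen (U i)) ∧ K ⊆ ⋃ i ∈ t, U i ∧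
      (∀ i, Metric.ediam (U i) ≤ δ) ∧ ∑ i ∈ t, Metric.ediam (U i) ≤ μH[1] K + ε := by
  have hδ2 : 0 < δ / 2 := by positivity
  have hε2 : 0 < ε / 2 := by positivity
  obtain ⟨s, hs, hsδ, hsum⟩ : ∃ s : ℕ → Set X, K ⊆ ⋃ n, s n ∧
      (∀ n, Metric.ediam (s n) ≤ (δ / 2 : ℝ≥0)) ∧
      ∑' n, Metric.ediam (s n) < μH[1] K + (ε / 2 : ℝ≥0) := by
    have hlt : μH[1] K < μH[1] K + (ε / 2 : ℝ≥0) :=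
      ENNReal.lt_add_right hfin (by exact_mod_cast hε2.ne')
    have hle := Measure.hausdorffMeasure_apply 1 K ▸ le_iSup₂_of_le (f := fun (r : ℝ≥0∞)
      (_ : 0 < r) => ⨅ (t : ℕ → Set X) (_ : K ⊆ ⋃ n, t n) (_ : ∀ n, Metric.ediam (t n) ≤ r),
          ∑' n, ⨆ _ : (t n).Nonempty, Metric.ediam (t n) ^ (1 : ℝ)) ((δ / 2 : ℝ≥0) : ℝ≥0∞)
          (by exact_mod_cast hδ2) le_rfl
    have := hle.trans_lt hlt
    simp only [iInf_lt_iff] at this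
    obtain ⟨s, hs, hsδ, hsum⟩ := this
    refine ⟨s, hs, hsδ, lt_of_le_of_lt (ENNReal.tsum_le_tsum fun n => ?_) hsum⟩
    rcases (s n).eq_empty_or_nonempty with h | h
    · simp [h]
    · simp [h]
  obtain ⟨η, hη, hηsum⟩ := ENNReal.exists_pos_sum_of_countable
    (ε := ((min (δ / 2) (ε / 2) : ℝ≥0) : ℝ≥0∞))
    (by exact_mod_cast (lt_min hδ2 hε2).ne') ℕ
  have hηle : ∀ n, (η n : ℝ≥0∞) ≤ (min (δ / 2) (ε / 2) : ℝ≥0) :=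
    fun n => (ENNReal.le_tsum n).trans hηsum.le
  choose U hUo hsU hUd using fun n => Metric.exists_isOpen_superset_ediam_le (s n) (hη n)
  obtain ⟨t, ht⟩ := hK.elim_finite_subcover U hUo (hs.trans (Set.iUnion_mono hsU))
  refine ⟨t, U, hUo, ht, fun n => (hUd n).trans ?_, ?_⟩
  · calc _ ≤ ((δ / 2 : ℝ≥0) : ℝ≥0∞) + (δ / 2 : ℝ≥0) := by
          gcongr
          · exact hsδ n
          · exact ENNReal.coe_le_coe.1
              ((hηle n).trans (ENNReal.coe_le_coe.2 (min_le_left _ _)))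
      _ = δ := by norm_cast; exact add_halves δ
  · calc _ ≤ ∑' n, Metric.ediam (U n) := ENNReal.sum_le_tsum t
      _ ≤ ∑' n, (Metric.ediam (s n) + η n) := ENNReal.tsum_le_tsum hUd
      _ = ∑' n, Metric.ediam (s n) + ∑' n, (η n : ℝ≥0∞) := ENNReal.tsum_add
      _ ≤ (μH[1] K + (ε / 2 : ℝ≥0)) + (ε / 2 : ℝ≥0) := by
          gcongr
          exact hηsum.le.trans (ENNReal.coe_le_coe.2 (min_le_right _ _))
      _ = μH[1] K + ε := by rw [add_assoc]; norm_cast; rw [add_halves]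

end Cover

/-- The graph in which two indices are adjacent if the corresponding sets intersect. -/
def SimpleGraph.intersectionGraph {V X : Type*} (U : V → Set X) : SimpleGraph V :=
  SimpleGraph.fromRel fun a b => (U a ∩ U b).Nonempty

theorem SimpleGraph.reachable_intersectionGraph {V X : Type*} {U : V → Set X} {a b : V} {x : X}
    (ha : x ∈ U a) (hb : x ∈ U b) : (intersectionGraph U).Reachable a b := by
  by_cases h : a = b
  · exact h ▸ Reachable.refl _
  · exact Adj.reachable ((fromRel_adj _ _ _).2 ⟨h, Or.inl ⟨x, ha, hb⟩⟩)

/-- If a preconnected set `C` is covered by open sets whose traces on `C` are contained in members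
of a family, any two members of the family meeting `C` are linked in the intersection graph. -/
theorem IsPreconnected.reachable_intersectionGraph {ι V X : Type*} [TopologicalSpace X]
    {C : Set X} (hC : IsPreconnected C) {O : ι → Set X} (hO : ∀ i, IsOpen (O i))
    (hCO : C ⊆ ⋃ i, O i) {U : V → Set X} (φ : ι → V) (hφ : ∀ i, O i ∩ C ⊆ U (φ i))
    {a b : V} {x y : X} (hx : x ∈ C) (hxa : x ∈ U a) (hy : y ∈ C) (hyb : y ∈ U b) :
    (SimpleGraph.intersectionGraph U).Reachable a b := by
  set G := SimpleGraph.intersectionGraph U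
  obtain ⟨i, hi⟩ := Set.mem_iUnion.1 (hCO hx)
  obtain ⟨j, hj⟩ := Set.mem_iUnion.1 (hCO hy)
  have hai : G.Reachable a (φ i) := SimpleGraph.reachable_intersectionGraph hxa (hφ i ⟨hi, hx⟩)
  have hjb : G.Reachable (φ j) b := SimpleGraph.reachable_intersectionGraph (hφ j ⟨hj, hy⟩) hyb
  by_contra hab
  have hjr : ¬ G.Reachable a (φ j) := fun h => hab (h.trans hjb)
  obtain ⟨w, hwC, hw₁, hw₂⟩ := hC (⋃ k ∈ {k | G.Reachable a (φ k)}, O k)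
    (⋃ k ∈ {k | ¬ G.Reachable a (φ k)}, O k)
    (isOpen_biUnion fun _ _ => hO _) (isOpen_biUnion fun _ _ => hO _)
    (fun w hw => by
      obtain ⟨k, hk⟩ := Set.mem_iUnion.1 (hCO hw)
      by_cases h : G.Reachable a (φ k)
      · exact Or.inl (Set.mem_biUnion (show k ∈ {k | G.Reachable a (φ k)} from h) hk)
      · exact Or.inr (Set.mem_biUnion (show k ∈ {k | ¬ G.Reachable a (φ k)} from h) hk))
    ⟨x, hx, Set.mem_biUnion (show i ∈ {k | G.Reachable a (φ k)} from hai) hi⟩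
    ⟨y, hy, Set.mem_biUnion (show j ∈ {k | ¬ G.Reachable a (φ k)} from hjr) hj⟩
  simp only [Set.mem_iUnion] at hw₁ hw₂
  obtain ⟨k, hk, hwk⟩ := hw₁
  obtain ⟨l, hl, hwl⟩ := hw₂
  exact hl (SimpleGraph.Reachable.trans hk
    (SimpleGraph.reachable_intersectionGraph (hφ k ⟨hwk, hwC⟩) (hφ l ⟨hwl, hwC⟩)))

/-- A preconnected set lies within its length from each of its points. -/
theorem IsPreconnected.edist_le_hausdorffMeasure_one {X : Type*} [MetricSpace X]
    [MeasurableSpace X] [BorelSpace X] {C : Set X} (hC : IsPreconnected C) {x y : X} (hx : x ∈ C)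
    (hy : y ∈ C) : edist x y ≤ μH[1] C := by
  have hf : LipschitzWith 1 fun z => dist z y := LipschitzWith.dist_left y
  have h₁ : μH[1] ((fun z => dist z y) '' C) ≤ μH[1] C := by
    simpa using hf.hausdorffMeasure_image_le zero_le_one C
  have h₂ : Set.Icc 0 (dist x y) ⊆ (fun z => dist z y) '' C := by
    have := (hC.image _ hf.continuous.continuousOn).Icc_subset
      (Set.mem_image_of_mem _ hy) (Set.mem_image_of_mem _ hx)
    simpa using this
  have h₃ := measure_mono (μ := μH[1]) h₂
  rw [hausdorffMeasure_real, Real.volume_Icc, sub_zero, ← edist_dist] at h₃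
  exact h₃.trans (hausdorffMeasure_real ▸ h₁)

section Network

variable {V E : Type*} [NormedAddCommGroup E] [NormedSpace ℝ E]

/-- The straight-line drawing of a graph with vertices at the points `f v`. -/
def network (H : SimpleGraph V) (f : V → E) : Set E :=
  ⋃ e ∈ H.edgeSet, Sym2.lift ⟨fun a b => segment ℝ (f a) (f b), fun _ _ => segment_symm _ _ _⟩ e

theorem segment_subset_network {H : SimpleGraph V} (f : V → E) {a b : V} (h : H.Adj a b) :
    segment ℝ (f a) (f b) ⊆ network H f :=
  Set.subset_biUnion_of_mem (u := fun e => Sym2.lift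
    ⟨fun a b => segment ℝ (f a) (f b), fun _ _ => segment_symm _ _ _⟩ e)
    (show s(a, b) ∈ H.edgeSet from h)

theorem isCompact_network [Finite V] (H : SimpleGraph V) (f : V → E) : IsCompact (network H f) := by
  refine (Set.toFinite _).isCompact_biUnion fun e _ => ?_
  induction e with | _ a b =>
  simp only [Sym2.lift_mk, segment_eq_image_lineMap]
  exact isCompact_Icc.image AffineMap.lineMap_continuous

theorem hausdorffMeasure_network_le [Fintype V] [MeasurableSpace E] [BorelSpace E]
    (H : SimpleGraph V) (f : V → E) : μH[1] (network H f) ≤ ENNReal.ofReal (networkLength H f) := by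
  classical
  have : network H f = ⋃ e ∈ H.edgeFinset, Sym2.lift
      ⟨fun a b => segment ℝ (f a) (f b), fun _ _ => segment_symm _ _ _⟩ e := by
    simp [network]
  rw [this, networkLength, ENNReal.ofReal_sum_of_nonneg]
  · refine (measure_biUnion_finset_le _ _).trans_eq (Finset.sum_congr (by congr) fun e _ => ?_)
    induction e with | _ a b =>
    simp only [Sym2.lift_mk, hausdorffMeasure_segment, edist_dist]
  · intro e _
    induction e with | _ a b => exact dist_nonneg

theorem connectedComponentIn_eq_of_reachable {H : SimpleGraph V} {f : V → E} {K : Set E}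
    (hK : network H f ⊆ K) {a b : V} (h : H.Reachable a b) :
    connectedComponentIn K (f a) = connectedComponentIn K (f b) := by
  obtain ⟨p⟩ := h
  induction p with
  | nil => rfl
  | cons hadj _ ih =>
    rw [← ih]
    refine connectedComponentIn_eq ((convex_segment _ _).isPreconnected.subset_connectedComponentIn
      (left_mem_segment ℝ _ _) ((segment_subset_network f hadj).trans hK)
      (right_mem_segment ℝ _ _))

end Network

/-- Straight-line networks with a controlled number of vertices, which connect given points in the
same way as a compact set does, come arbitrarily close to the one-dimensional Hausdorff measure of
that set. -/
theorem exists_networkLength_le {E : Type*} [NormedAddCommGroup E] [MeasurableSpace E]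
    [BorelSpace E] {n : ℕ} (p : Fin n → E) (r : Fin n → Fin n → Prop) {K K' : Set E}
    (hK : IsCompact K) (hfin : μH[1] K ≠ ⊤) (hK' : K' ⊆ K) {R : ℝ} (hR : 0 ≤ R)
    (hKR : K' ⊆ Metric.closedBall 0 R) (hp : ∀ j, p j ∈ K')
    (hr : ∀ i j, r i j → ∃ C ⊆ K', IsPreconnected C ∧ p i ∈ C ∧ p j ∈ C) {ε : ℝ} (hε : 0 < ε) :
    ∃ (H : SimpleGraph (Fin (3 * n + 1))) (τ : Fin n → Fin (3 * n + 1))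
      (f : Fin (3 * n + 1) → E), (∀ i j, r i j → H.Reachable (τ i) (τ j)) ∧
      (∀ i, f i ∈ Metric.closedBall 0 R) ∧ (∀ j, f (τ j) = p j) ∧
      networkLength H f ≤ (μH[1] K).toReal + ε := by
  classical
  set δ : ℝ := ε / (2 * (6 * n + 1)) with hδ
  have hδ0 : 0 < δ := by positivity
  obtain ⟨t, U, hUo, hKU, hUδ, hUsum⟩ := hK.exists_open_cover_sum_ediam_le hfin
    (Real.toNNReal_pos.2 hδ0) (Real.toNNReal_pos.2 (half_pos hε))
  have hUtop : ∀ i, Metric.ediam (U i) ≠ ⊤ := fun i =>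
    ((hUδ i).trans_lt ENNReal.coe_lt_top).ne
  let u : t ⊕ Fin n → Set E := Sum.elim (fun i => U i ∩ K') (fun j => {p j})
  let w : t ⊕ Fin n → ℝ := Sum.elim (fun i => (Metric.ediam (U i)).toReal) (fun _ => 0)
  let z : t ⊕ Fin n → E := fun v => if h : (u v).Nonempty then h.some else 0
  have hz : ∀ v, (u v).Nonempty → z v ∈ u v := fun v h => by
    simp only [z, dif_pos h]
    exact h.some_mem
  have huK : ∀ v, u v ⊆ K' := by
    rintro (i | j)
    · exact Set.inter_subset_right
    · exact Set.singleton_subset_iff.2 (hp j)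
  have hzR : ∀ v, z v ∈ Metric.closedBall (0 : E) R := fun v => by
    by_cases h : (u v).Nonempty
    · exact hKR (huK v (hz v h))
    · simp only [z, dif_neg h]
      exact Metric.mem_closedBall_self hR
  let T : Finset (t ⊕ Fin n) := Finset.univ.map ⟨Sum.inr, Sum.inr_injective⟩
  have hT : T.card = n := by simp [T]
  have hTmem : ∀ j, Sum.inr j ∈ T := fun j => by simp [T]
  have hsum : ∑ v, w v ≤ (μH[1] K).toReal + ε / 2 := by
    have h₁ : ∑ v, w v = (∑ i ∈ t, Metric.ediam (U i)).toReal := by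
      rw [ENNReal.toReal_sum fun i _ => hUtop i, Fintype.sum_sum_type]
      simp only [w, Sum.elim_inl, Sum.elim_inr, Finset.sum_const_zero, add_zero]
      exact Finset.sum_coe_sort t fun i => (Metric.ediam (U i)).toReal
    rw [h₁]
    refine (ENNReal.toReal_mono (by simp [hfin]) hUsum).trans_eq ?_
    rw [ENNReal.toReal_add hfin ENNReal.coe_ne_top, ENNReal.coe_toReal,
      Real.coe_toNNReal _ (half_pos hε).le]
  obtain ⟨B, H, hTB, hHB, hBcard, hHr, hHlen⟩ := SimpleGraph.exists_sparse_network u z hz w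
    (by rintro (i | j) <;> simp [w])
    (by
      rintro (i | j) x hx y hy
      · rw [dist_edist]
        exact ENNReal.toReal_mono (hUtop i) (Metric.edist_le_ediam_of_mem hx.1 hy.1)
      · rw [Set.mem_singleton_iff.1 hx, Set.mem_singleton_iff.1 hy]
        simp [w])
    (δ := δ)
    (by
      rintro (i | j)
      · refine (ENNReal.toReal_mono ENNReal.coe_ne_top (hUδ i)).trans_eq ?_
        rw [ENNReal.coe_toReal, Real.coe_toNNReal _ hδ0.le]
      · exact hδ0.le)
    T Finset.univ (SimpleGraph.intersectionGraph u) (fun _ => 0) (Finset.subset_univ _) (by simp)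
    (fun _ => le_rfl)
    (fun a b hab => by
      obtain ⟨x, hxa, hxb⟩ : (u a ∩ u b).Nonempty := by
        rcases ((SimpleGraph.fromRel_adj _ _ _).1 hab).2 with h | h
        · exact h
        · exact Set.inter_comm _ _ ▸ h
      exact ⟨x, hxa, x, hxb, by simp⟩)
    (by simpa using hsum)
  obtain ⟨g, -, hg⟩ := B.finite_toSet.exists_injOn_of_encard_le (β := Fin (3 * n + 1))
    (t := Set.univ) (by
      rw [Set.encard_coe_eq_coe_finsetCard, Set.encard_univ, ENat.card_eq_coe_fintype_card,
        Fintype.card_fin]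
      exact_mod_cast (by omega : B.card ≤ 3 * n + 1))
  let f : Fin (3 * n + 1) → E := fun i => if h : ∃ v ∈ B, g v = i then z h.choose else 0
  have hf : ∀ v ∈ B, f (g v) = z v := fun v hv => by
    have h : ∃ v' ∈ B, g v' = g v := ⟨v, hv, rfl⟩
    have h' : h.choose = v := hg h.choose_spec.1 hv h.choose_spec.2
    simp only [f, dif_pos h, h']
  refine ⟨H.map g, g ∘ Sum.inr, f, fun i j hij => ?_, fun i => ?_, fun j => ?_, ?_⟩
  · obtain ⟨C, hCK, hC, hi, hj⟩ := hr i j hij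
    have hreach : (SimpleGraph.intersectionGraph u).Reachable (Sum.inr i) (Sum.inr j) :=
      hC.reachable_intersectionGraph (O := fun i : t => U i) (fun i => hUo i)
        (by simpa [Set.iUnion_subtype] using hCK.trans (hK'.trans hKU)) Sum.inl
        (fun i => Set.inter_subset_inter_right _ hCK) hi (Set.mem_singleton _) hj
        (Set.mem_singleton _)
    refine (hHr _ (hTmem i) _ (hTmem j) hreach).map_of_adj g fun a b hab => ?_
    have hne : g a ≠ g b := fun h => hab.ne (hg (hHB ⟨b, hab⟩) (hHB ⟨a, hab.symm⟩) h)
    exact (SimpleGraph.map_adj_apply' hab hne).reachable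
  · by_cases h : ∃ v ∈ B, g v = i
    · simp only [f, dif_pos h]
      exact hzR _
    · simp only [f, dif_neg h]
      exact Metric.mem_closedBall_self hR
  · exact (hf _ (hTB (hTmem j))).trans (hz (Sum.inr j) (Set.singleton_nonempty _))
  · refine (networkLength_map_le H g f).trans ?_
    rw [networkLength_congr (f := f ∘ g) (g := z) fun v hv => hf v (hHB hv)]
    refine hHlen.trans ?_
    have : 6 * (n : ℝ) * δ ≤ ε / 2 := by
      rw [hδ, mul_div_assoc', div_le_div_iff₀ (by positivity) two_pos]
      nlinarith
    rw [hT]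
    linarith

/-- Existence of a minimizer of the partitioned Steiner tree problem. -/
theorem exists_minimizer_partitioned_steiner (d n k : ℕ)
    (p : Fin n → EuclideanSpace ℝ (Fin d))
    (P : Fin k → Set (EuclideanSpace ℝ (Fin d)))
    (hcover : ⋃ i, P i = Set.range p)
    (hdisj : ∀ i j : Fin k, i ≠ j → Disjoint (P i) (P j))
    (hne : ∀ i : Fin k, (P i).Nonempty) :
    ∃ Ktilde : Set (EuclideanSpace ℝ (Fin d)),
      IsPartSteinerCompetitor p P Ktilde ∧
        ∀ K : Set (EuclideanSpace ℝ (Fin d)),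
          IsPartSteinerCompetitor p P K → μH[1] Ktilde ≤ μH[1] K := by
  have hPp : ∀ l, ∀ x ∈ P l, ∃ i, p i = x := fun l x hx =>
    (hcover ▸ Set.mem_iUnion_of_mem l hx : x ∈ Set.range p)
  by_cases hex : ∃ K, IsPartSteinerCompetitor p P K ∧ μH[1] K ≠ ⊤
  swap
  · push Not at hex
    refine ⟨convexHull ℝ (Set.range p), ⟨(Set.finite_range p).isCompact_convexHull ℝ,
      subset_convexHull ℝ _, fun l x hx y hy => ?_⟩, fun K hK => hex K hK ▸ le_top⟩
    have hsub : ∀ x ∈ P l, x ∈ convexHull ℝ (Set.range p) := fun x hx =>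
      subset_convexHull ℝ _ (hPp l x hx)
    exact connectedComponentIn_eq <|
      (convex_convexHull ℝ _).isPreconnected.subset_connectedComponentIn
        (hsub x hx) le_rfl (hsub y hy)
  obtain ⟨K₀, hK₀, hfin₀⟩ := hex
  set L := (μH[1] K₀).toReal
  set R := ∑ i, ‖p i‖ + L
  have hR0 : 0 ≤ R := by positivity
  set r : Fin n → Fin n → Prop := fun i j => ∃ l, p i ∈ P l ∧ p j ∈ P l
  set F : (Fin n → Fin (3 * n + 1)) → Set (Fin (3 * n + 1) → EuclideanSpace ℝ (Fin d)) :=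
    fun τ => {f | (∀ i, f i ∈ Metric.closedBall 0 R) ∧ ∀ j, f (τ j) = p j}
  have hFc : ∀ τ, IsCompact (F τ) := by
    intro τ
    have h₁ : IsCompact {f : Fin (3 * n + 1) → EuclideanSpace ℝ (Fin d) |
        ∀ i, f i ∈ Metric.closedBall 0 R} :=
      isCompact_pi_infinite fun _ => isCompact_closedBall _ _
    refine h₁.inter_right (t := {f | ∀ j, f (τ j) = p j}) ?_
    simp only [Set.ofPred_forall]
    exact isClosed_iInter fun j => isClosed_eq (continuous_apply _) continuous_const
  set A : Set ℝ := ⋃ (H : SimpleGraph (Fin (3 * n + 1))) (τ : Fin n → Fin (3 * n + 1))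
    (_ : ∀ i j, r i j → H.Reachable (τ i) (τ j)), networkLength H '' F τ with hA
  have hAc : IsCompact A :=
    isCompact_iUnion fun H => isCompact_iUnion fun τ => isCompact_iUnion fun _ =>
      (hFc τ).image (continuous_networkLength H)
  have happrox : ∀ K, IsPartSteinerCompetitor p P K → μH[1] K ≤ μH[1] K₀ →
      ∀ ε > 0, ∃ a ∈ A, a ≤ (μH[1] K).toReal + ε := by
    rintro K ⟨hKc, hpK, hKP⟩ hKK₀ ε hε
    have hmem : ∀ j, p j ∈ connectedComponentIn K (p j) := fun j =>
      mem_connectedComponentIn (hpK ⟨j, rfl⟩)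
    obtain ⟨H, τ, f, h₁, h₂, h₃, h₄⟩ := exists_networkLength_le p r hKc
      (hKK₀.trans_lt hfin₀.lt_top).ne
      (K' := ⋃ j, connectedComponentIn K (p j))
      (Set.iUnion_subset fun j => connectedComponentIn_subset _ _) hR0
      (Set.iUnion_subset fun j x hx => by
        have h := isPreconnected_connectedComponentIn.edist_le_hausdorffMeasure_one hx (hmem j)
        have h' := ENNReal.toReal_mono hfin₀
          (h.trans ((measure_mono (connectedComponentIn_subset _ _)).trans hKK₀))
        rw [← dist_edist, dist_eq_norm] at h'
        have hj : ‖p j‖ ≤ ∑ i, ‖p i‖ :=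
          Finset.single_le_sum (f := fun i => ‖p i‖) (fun i _ => norm_nonneg _)
            (Finset.mem_univ j)
        rw [mem_closedBall_zero_iff]
        have := norm_le_norm_add_norm_sub' x (p j)
        linarith)
      (fun j => Set.mem_iUnion_of_mem j (hmem j))
      (fun i j ⟨l, hi, hj⟩ => ⟨connectedComponentIn K (p i),
        Set.subset_iUnion (fun j => connectedComponentIn K (p j)) i,
        isPreconnected_connectedComponentIn, hmem i, hKP l _ hi _ hj ▸ hmem j⟩) hε
    exact ⟨_, by simp only [hA, Set.mem_iUnion]; exact ⟨H, τ, h₁, f, ⟨h₂, h₃⟩, rfl⟩, h₄⟩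
  obtain ⟨m, hmA, hm⟩ := hAc.exists_isLeast
    (by obtain ⟨a, ha, -⟩ := happrox K₀ hK₀ le_rfl 1 one_pos; exact ⟨a, ha⟩)
  have hmK : ∀ K, IsPartSteinerCompetitor p P K → μH[1] K ≤ μH[1] K₀ →
      ENNReal.ofReal m ≤ μH[1] K := by
    intro K hK hKK₀
    rw [← ENNReal.ofReal_toReal (hKK₀.trans_lt hfin₀.lt_top).ne]
    refine ENNReal.ofReal_le_ofReal (le_of_forall_pos_le_add fun ε hε => ?_)
    obtain ⟨a, ha, hle⟩ := happrox K hK hKK₀ ε hε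
    exact (hm ha).trans hle
  simp only [hA, Set.mem_iUnion] at hmA
  obtain ⟨H, τ, hHr, f, ⟨-, hfp⟩, rfl⟩ := hmA
  refine ⟨Set.range p ∪ network H f, ⟨(Set.finite_range p).isCompact.union (isCompact_network H f),
    Set.subset_union_left, fun l x hx y hy => ?_⟩, fun K hK => ?_⟩
  · obtain ⟨i, rfl⟩ := hPp l x hx
    obtain ⟨j, rfl⟩ := hPp l y hy
    rw [← hfp i, ← hfp j]
    exact connectedComponentIn_eq_of_reachable Set.subset_union_right (hHr i j ⟨l, hx, hy⟩)
  · have hp0 : μH[1] (Set.range p) = 0 := by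
      have := Measure.nullSingletonClass_hausdorff (EuclideanSpace ℝ (Fin d)) one_pos
      exact (Set.finite_range p).measure_zero _
    have hle : μH[1] (Set.range p ∪ network H f) ≤ ENNReal.ofReal (networkLength H f) := by
      refine (measure_union_le _ _).trans ?_
      rw [hp0, zero_add]
      exact hausdorffMeasure_network_le H f
    rcases le_total (μH[1] K) (μH[1] K₀) with h | h
    · exact hle.trans (hmK K hK h)
    · exact hle.trans ((hmK K₀ hK₀ le_rfl).trans h)
end

section
/- Let $S=\{p_1,\ldots,p_n\}\subset\mathbb{R}^d$ be a finite set of points and let $S_1,\ldots,S_k$ be a partition of $S$. Then there exists a compact set $\widetilde K\subset\mathbb{R}^d$ which is a competitor for the partitioned Steiner tree problem, has minimal $\mathcal{H}^1$-measure among all compact competitors, and has at most $k$ connected components. -/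
open MeasureTheory

/-- A multigraph with edges `e` joining `s e` and `t e` is connected if the only nonempty
set of vertices closed under adjacency is the set of all vertices. -/
def EdgeConnected {V E : Type*} (s t : E → V) : Prop :=
  ∀ S : Set V, S.Nonempty → (∀ e, s e ∈ S ↔ t e ∈ S) → S = Set.univ

/-- A tree whose vertices `v` are thickened to sets `U v` of diameter
at most `w v` around base points `x v`, and whose edges `e` bridge gaps of length at most `c e`
between the thickened endpoints. -/
structure IsThickTree {X V E : Type*} [PseudoMetricSpace X] [Fintype V] [Fintype E]
    (s t : E → V) (U : V → Set X) (x : V → X) (w : V → ℝ) (c : E → ℝ) : Prop where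
  conn : EdgeConnected s t
  card_eq : Fintype.card E + 1 = Fintype.card V
  mem : ∀ v, x v ∈ U v
  w_nonneg : ∀ v, 0 ≤ w v
  c_nonneg : ∀ e, 0 ≤ c e
  dist_le : ∀ v, ∀ p ∈ U v, ∀ q ∈ U v, dist p q ≤ w v
  gap_le : ∀ e, ∃ p ∈ U (s e), ∃ q ∈ U (t e), dist p q ≤ c e

/-- A vertex of a connected multigraph with another vertex has an edge leaving it. -/
theorem EdgeConnected.exists_edge {V E : Type*} {s t : E → V} (h : EdgeConnected s t)
    {u v : V} (huv : u ≠ v) : ∃ e, ¬ (s e = v ↔ t e = v) := by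
  by_contra! hc
  have h1 := h {v} ⟨v, rfl⟩ hc
  exact huv (by simpa using h1.symm.subset (Set.mem_univ u))

theorem EdgeConnected.comp {V W E : Type*} {s t : E → V} (h : EdgeConnected s t)
    {r : V → W} (hr : Function.Surjective r) :
    EdgeConnected (r ∘ s) (r ∘ t) := by
  intro S hS hE
  have h1 := h (r ⁻¹' S) (hS.preimage hr) hE
  rw [← Set.image_preimage_eq S hr, h1, Set.image_univ, hr.range_eq]

/-- In a tree with enough vertices, some unmarked vertex has degree at most two. -/
theorem EdgeConnected.exists_degree_le_two {V E ι : Type*} [Fintype V] [Fintype E] [Fintype ι]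
    [Nonempty ι] [DecidableEq V] {s t : E → V} (f : ι → V) (h : EdgeConnected s t)
    (hcard : Fintype.card E + 1 = Fintype.card V)
    (hlarge : 2 * Fintype.card ι < Fintype.card V) :
    ∃ v, (∀ i, f i ≠ v) ∧
      (Finset.univ.filter fun e => s e = v ∨ t e = v).card ≤ 2 := by
  by_contra! hc
  have hι : 0 < Fintype.card ι := Fintype.card_pos
  have hdeg : ∀ v, 1 ≤ (Finset.univ.filter fun e => s e = v ∨ t e = v).card := by
    intro v
    have : Nontrivial V := Fintype.one_lt_card_iff_nontrivial.1 (by omega)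
    obtain ⟨u, hu⟩ := exists_ne v
    obtain ⟨e, he⟩ := h.exists_edge hu
    exact Finset.card_pos.2 ⟨e, by simp; tauto⟩
  have hsum : ∑ v, (Finset.univ.filter fun e => s e = v ∨ t e = v).card
      ≤ Fintype.card E + Fintype.card E := by
    have h1 := Finset.card_eq_sum_card_fiberwise (f := s) (s := Finset.univ) (t := Finset.univ)
      (fun _ _ => Finset.mem_coe.2 (Finset.mem_univ _))
    have h2 := Finset.card_eq_sum_card_fiberwise (f := t) (s := Finset.univ) (t := Finset.univ)
      (fun _ _ => Finset.mem_coe.2 (Finset.mem_univ _))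
    rw [Finset.card_univ] at h1 h2
    calc _ ≤ ∑ v, ((Finset.univ.filter fun e => s e = v).card +
          (Finset.univ.filter fun e => t e = v).card) := by
            refine Finset.sum_le_sum fun v _ => ?_
            classical
            rw [Finset.filter_or]
            exact Finset.card_union_le _ _
      _ = _ := by rw [Finset.sum_add_distrib, ← h1, ← h2]
  have hlow : ∑ v : V, (if v ∈ Finset.univ.image f then 1 else 3) ≤
      ∑ v, (Finset.univ.filter fun e => s e = v ∨ t e = v).card := by
    refine Finset.sum_le_sum fun v _ => ?_
    split_ifs with hv
    · exact hdeg v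
    · exact hc v fun i hi => hv (by simp [← hi])
  have him : (Finset.univ.image f).card ≤ Fintype.card ι := Finset.card_image_le
  have h3 : ∑ v : V, (if v ∈ Finset.univ.image f then 1 else 3) + 2 * (Finset.univ.image f).card
      = 3 * Fintype.card V := by
    have : 2 * (Finset.univ.image f).card
        = ∑ v : V, (if v ∈ Finset.univ.image f then 2 else 0) := by
      rw [Finset.sum_ite_mem, Finset.univ_inter, Finset.sum_const, smul_eq_mul, mul_comm]
    rw [this, ← Finset.sum_add_distrib, Finset.sum_congr rfl (g := fun _ => 3)]
    · simp [mul_comm]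
    · intro v _; split_ifs <;> rfl
  omega

/-- Contracting an edge at a vertex of degree at most two. -/
theorem IsThickTree.exists_contraction {X V E : Type*} [PseudoMetricSpace X] [Fintype V]
    [Fintype E] [DecidableEq V] [DecidableEq E] {s t : E → V} {U : V → Set X}
    {x : V → X} {w : V → ℝ} {c : E → ℝ} (h : IsThickTree s t U x w c) {v : V}
    (hdeg : (Finset.univ.filter fun e => s e = v ∨ t e = v).card ≤ 2)
    (hV : ∃ u, u ≠ v) :
    ∃ (e₀ : E) (s' t' : {e // e ≠ e₀} → {u // u ≠ v}) (c' : {e // e ≠ e₀} → ℝ),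
      IsThickTree s' t' (fun u => U u) (fun u => x u)
        (fun u => w u) c' ∧
      ∑ e, c' e + ∑ u : {u // u ≠ v}, w u ≤ ∑ e, c e + ∑ u, w u := by
  obtain ⟨u, hu⟩ := hV
  obtain ⟨e₀, he₀⟩ := h.conn.exists_edge hu
  have gap_comm : ∀ {a b : V} {r : ℝ}, (∃ p ∈ U a, ∃ q ∈ U b, dist p q ≤ r) →
      ∃ p ∈ U b, ∃ q ∈ U a, dist p q ≤ r := by
    rintro a b r ⟨p, hp, q, hq, hpq⟩
    exact ⟨q, hq, p, hp, by rwa [dist_comm]⟩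
  have gap_trans : ∀ {a b : V} {r r' : ℝ}, (∃ p ∈ U a, ∃ q ∈ U v, dist p q ≤ r) →
      (∃ p ∈ U v, ∃ q ∈ U b, dist p q ≤ r') →
      ∃ p ∈ U a, ∃ q ∈ U b, dist p q ≤ r + (w v + r') := by
    rintro a b r r' ⟨p, hp, q, hq, hpq⟩ ⟨p', hp', q', hq', hpq'⟩
    refine ⟨p, hp, q', hq', ?_⟩
    have h1 := dist_triangle p q q'
    have h2 := dist_triangle q p' q'
    have h3 := h.dist_le v q hq p' hp'
    linarith
  obtain ⟨a, hav, hgap, hends⟩ : ∃ a, a ≠ v ∧ (∃ p ∈ U v, ∃ q ∈ U a, dist p q ≤ c e₀) ∧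
      ((s e₀ = v ∧ t e₀ = a) ∨ (s e₀ = a ∧ t e₀ = v)) := by
    by_cases hs : s e₀ = v
    · refine ⟨t e₀, by tauto, ?_, .inl ⟨hs, rfl⟩⟩
      simpa [hs] using h.gap_le e₀
    · have ht : t e₀ = v := by tauto
      refine ⟨s e₀, hs, gap_comm ?_, .inr ⟨rfl, ht⟩⟩
      simpa [ht] using h.gap_le e₀
  let r : V → {u // u ≠ v} := fun u => if hu : u = v then ⟨a, hav⟩ else ⟨u, hu⟩
  have hrv : r v = ⟨a, hav⟩ := by simp [r]
  have hrn : ∀ b (hb : b ≠ v), r b = ⟨b, hb⟩ := fun b hb => by simp [r, hb]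
  have hr : Function.Surjective r := fun b => ⟨b, hrn b b.2⟩
  let c' : {e // e ≠ e₀} → ℝ := fun e =>
    c e + if s e = v ∨ t e = v then w v + c e₀ else 0
  have hw := h.w_nonneg v
  have hc := h.c_nonneg e₀
  refine ⟨e₀, fun e => r (s e), fun e => r (t e), c', ⟨?_, ?_, fun u => h.mem u,
    fun u => h.w_nonneg u, ?_, fun u => h.dist_le u, ?_⟩, ?_⟩
  · intro S hS hE
    refine h.conn.comp hr S hS fun e => ?_
    by_cases he : e = e₀
    · subst he
      rcases hends with ⟨h1, h2⟩ | ⟨h1, h2⟩ <;> simp [h1, h2, hrv, hrn a hav]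
    · exact hE ⟨e, he⟩
  · have := h.card_eq
    have h1 : 0 < Fintype.card E := Fintype.card_pos_iff.2 ⟨e₀⟩
    have e1 : Fintype.card {e // e ≠ e₀} = Fintype.card E - 1 := by
      simp
    have e2 : Fintype.card {u // u ≠ v} = Fintype.card V - 1 := by
      simp
    omega
  · intro e
    have := h.c_nonneg e
    simp only [c']
    split_ifs <;> linarith
  · intro e
    have hce := h.c_nonneg e
    by_cases h1 : s e = v <;> by_cases h2 : t e = v
    · refine ⟨x a, ?_, x a, ?_, ?_⟩
      · simpa [h1, hrv] using h.mem a
      · simpa [h2, hrv] using h.mem a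
      · simp only [dist_self, c', h1, true_or, if_true]
        linarith
    · have := h.gap_le e
      rw [h1] at this
      have := gap_comm (gap_trans (gap_comm this) hgap)
      simpa [c', h1, hrv, hrn _ h2] using this
    · have := h.gap_le e
      rw [h2] at this
      have := gap_trans this hgap
      simpa [c', h2, hrv, hrn _ h1] using this
    · simpa [c', h1, h2, hrn] using h.gap_le e
  · have hsplitV : ∑ u : V, w u = w v + ∑ u : {u // u ≠ v}, w u :=
      Fintype.sum_eq_add_sum_subtype_ne w v
    have hsplitE : ∑ e : E, c e = c e₀ + ∑ e : {e // e ≠ e₀}, c e :=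
      Fintype.sum_eq_add_sum_subtype_ne c e₀
    have hsum : ∑ e : {e // e ≠ e₀}, (if s e = v ∨ t e = v then w v + c e₀ else 0)
        ≤ w v + c e₀ := by
      have h1 : ∑ e : E, (if s e = v ∨ t e = v then w v + c e₀ else 0) ≤
          2 * (w v + c e₀) := by
        rw [← Finset.sum_filter, Finset.sum_const, nsmul_eq_mul]
        gcongr
        exact_mod_cast hdeg
      rw [Fintype.sum_eq_add_sum_subtype_ne _ e₀, if_pos (by tauto)] at h1
      linarith
    simp only [c', Finset.sum_add_distrib]
    linarith

/-- Every thick tree can be replaced by a tree with a bounded number of vertices and straight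
edges, with a controlled increase of total length. -/
theorem IsThickTree.exists_tree {X ι : Type*} [PseudoMetricSpace X] [Fintype ι] [Nonempty ι]
    {C : Set X} {a : ι → X} {δ : ℝ} (hδ : 0 ≤ δ) (N : ℕ) : ∀ {V E : Type} [Fintype V] [Fintype E]
    {s t : E → V} {f : ι → V} {U : V → Set X} {x : V → X} {w : V → ℝ} {c : E → ℝ},
    IsThickTree s t U x w c → Fintype.card V = N → (∀ v, x v ∈ C) →
    (∀ i, x (f i) = a i) → (∀ v, w v ≤ δ) →
    ∃ m < 2 * Fintype.card ι, ∃ (s' t' : Fin m → Fin (m + 1)) (f' : ι → Fin (m + 1))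
      (x' : Fin (m + 1) → X), EdgeConnected s' t' ∧ (∀ i, x' (f' i) = a i) ∧ (∀ v, x' v ∈ C) ∧
      ∑ e, dist (x' (s' e)) (x' (t' e)) ≤
        ∑ e, c e + ∑ v, w v + 2 * Fintype.card ι * (2 * δ) := by
  induction N using Nat.strong_induction_on with
  | _ N ih =>
  intro V E _ _ s t f U x w c h hN hC ha hw
  classical
  by_cases hlarge : 2 * Fintype.card ι < Fintype.card V
  · obtain ⟨v, hv, hdeg⟩ := h.conn.exists_degree_le_two f h.card_eq hlarge
    have hV : ∃ u, u ≠ v := by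
      have : Nontrivial V := Fintype.one_lt_card_iff_nontrivial.1 (by
        have : 0 < Fintype.card ι := Fintype.card_pos
        omega)
      exact exists_ne v
    obtain ⟨e₀, s', t', c', h', hle⟩ := h.exists_contraction hdeg hV
    have hlt : Fintype.card {u // u ≠ v} < N := by
      rw [← hN]; exact Fintype.card_subtype_lt (x := v) (by simp)
    obtain ⟨m, hm, s'', t'', f'', x'', h1, h2, h3, h4⟩ :=
      ih _ hlt h' rfl (f := fun i => ⟨f i, hv i⟩)
        (fun u => hC u) (fun i => ha i) (fun u => hw u)
    exact ⟨m, hm, s'', t'', f'', x'', h1, h2, h3, by linarith⟩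
  · obtain ⟨m, hm⟩ : ∃ m, Fintype.card E = m := ⟨_, rfl⟩
    have hm' : Fintype.card V = m + 1 := by rw [← h.card_eq, hm]
    have eE := Fintype.equivFinOfCardEq hm
    have eV := Fintype.equivFinOfCardEq hm'
    refine ⟨m, by omega, fun e => eV (s (eE.symm e)), fun e => eV (t (eE.symm e)),
      fun i => eV (f i), fun v => x (eV.symm v), ?_, by simpa using ha, fun v => hC _, ?_⟩
    · intro S hS hE
      exact h.conn.comp eV.surjective S hS fun e => by simpa using hE (eE e)
    · simp only [Equiv.symm_apply_apply]
      rw [Equiv.sum_comp eE.symm (fun e => dist (x (s e)) (x (t e)))]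
      have hb : ∀ e, dist (x (s e)) (x (t e)) ≤ c e + 2 * δ := by
        intro e
        obtain ⟨p, hp, q, hq, hpq⟩ := h.gap_le e
        have h1 := h.dist_le _ _ (h.mem (s e)) p hp
        have h2 := h.dist_le _ q hq _ (h.mem (t e))
        have h3 := hw (s e)
        have h4 := hw (t e)
        have h5 := dist_triangle4 (x (s e)) p q (x (t e))
        linarith
      have hcardE : (Fintype.card E : ℝ) ≤ 2 * Fintype.card ι := by
        exact_mod_cast (by omega : Fintype.card E ≤ 2 * Fintype.card ι)
      calc _ ≤ ∑ e, (c e + 2 * δ) := Finset.sum_le_sum fun e _ => hb e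
        _ = ∑ e, c e + Fintype.card E * (2 * δ) := by
          rw [Finset.sum_add_distrib]; simp
        _ ≤ ∑ e, c e + 2 * Fintype.card ι * (2 * δ) := by gcongr
        _ ≤ _ := by
          have := Finset.sum_nonneg fun v (_ : v ∈ Finset.univ) => h.w_nonneg v
          linarith

/-- A finite closed cover of a connected set by nonempty sets contains a spanning tree of
pairwise intersections. -/
theorem IsPreconnected.exists_tree_of_closed_cover {X : Type*} [TopologicalSpace X] {V : Type}
    [Fintype V] [Nonempty V] {F : V → Set X} (hconn : IsPreconnected (⋃ v, F v))
    (hclosed : ∀ v, IsClosed (F v)) (hne : ∀ v, (F v).Nonempty) :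
    ∃ (E : Type) (_ : Fintype E) (s t : E → V), EdgeConnected s t ∧
      Fintype.card E + 1 = Fintype.card V ∧ ∀ e, (F (s e) ∩ F (t e)).Nonempty := by
  classical
  have key : ∀ S : Set V, S.Nonempty →
      (∀ u v, (F u ∩ F v).Nonempty → (u ∈ S ↔ v ∈ S)) → S = Set.univ := by
    intro S ⟨u, hu⟩ hS
    by_contra hne'
    obtain ⟨v, hv⟩ := (Set.ne_univ_iff_exists_notMem S).1 hne'
    have hcl : ∀ S : Set V, IsClosed (⋃ v ∈ S, F v) := fun S =>
      S.toFinite.isClosed_biUnion fun v _ => hclosed v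
    obtain ⟨z, -, hz1, hz2⟩ := isPreconnected_closed_iff.1 hconn _ _ (hcl S) (hcl Sᶜ)
      (by
        intro z hz
        obtain ⟨w, hw⟩ := Set.mem_iUnion.1 hz
        by_cases hwS : w ∈ S
        · exact .inl (Set.mem_biUnion hwS hw)
        · exact .inr (Set.mem_biUnion hwS hw))
      (by
        obtain ⟨z, hz⟩ := hne u
        exact ⟨z, Set.mem_iUnion_of_mem u hz, Set.mem_biUnion hu hz⟩)
      (by
        obtain ⟨z, hz⟩ := hne v
        exact ⟨z, Set.mem_iUnion_of_mem v hz, Set.mem_biUnion hv hz⟩)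
    simp only [Set.mem_iUnion, exists_prop] at hz1 hz2
    obtain ⟨u', hu', hzu⟩ := hz1
    obtain ⟨v', hv', hzv⟩ := hz2
    exact hv' ((hS u' v' ⟨z, hzu, hzv⟩).1 hu')
  let G : SimpleGraph V := SimpleGraph.fromRel fun u v => (F u ∩ F v).Nonempty
  have hG : G.Connected := by
    rw [SimpleGraph.connected_iff]
    refine ⟨fun u v => ?_, inferInstance⟩
    have := key {w | G.Reachable u w} ⟨u, SimpleGraph.Reachable.refl u⟩ (by
      intro a b hab
      by_cases h : a = b
      · rw [h]
      · have hadj : G.Adj a b := by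
          simp only [G, SimpleGraph.fromRel_adj]
          exact ⟨h, .inl hab⟩
        exact ⟨fun h => h.trans hadj.reachable, fun h => h.trans hadj.symm.reachable⟩)
    exact this.symm.subset (Set.mem_univ v)
  obtain ⟨T, hTG, hT⟩ := hG.exists_isTree_le
  have hout : ∀ e : T.edgeSet, T.Adj (e.1.out).1 (e.1.out).2 := by
    intro e
    have : s((e.1.out).1, (e.1.out).2) = e.1 := Quot.out_eq e.1
    rw [← SimpleGraph.mem_edgeSet, this]
    exact e.2
  refine ⟨T.edgeSet, inferInstance, fun e => (e.1.out).1, fun e => (e.1.out).2, ?_, ?_, ?_⟩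
  · rintro S ⟨u, hu⟩ hS
    have hadj : ∀ a b, T.Adj a b → (a ∈ S ↔ b ∈ S) := by
      intro a b hab
      have h1 := hS ⟨s(a, b), hab⟩
      have h2 : s((s(a, b).out).1, (s(a, b).out).2) = s(a, b) := Quot.out_eq s(a, b)
      rw [Sym2.eq_iff] at h2
      rcases h2 with ⟨h3, h4⟩ | ⟨h3, h4⟩ <;> simp only [h3, h4] at h1 <;> tauto
    refine Set.eq_univ_of_forall fun v => ?_
    obtain ⟨p⟩ := hT.connected.preconnected u v
    induction p with
    | nil => exact hu
    | cons h _ ih => exact ih ((hadj _ _ h).1 hu)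
  · rw [← hT.card_edgeFinset, SimpleGraph.edgeFinset_card]
  · intro e
    have := hTG (hout e)
    simp only [G, SimpleGraph.fromRel_adj] at this
    rcases this.2 with h | h
    · exact h
    · rwa [Set.inter_comm] at h

/-- A compact set of finite length is a finite union of small closed pieces whose diameters
almost add up to at most its length. -/
theorem IsCompact.exists_finite_closed_cover {X : Type*} [MetricSpace X] [MeasurableSpace X]
    [BorelSpace X] {C : Set X} (hC : IsCompact C) (hfin : μH[1] C ≠ ⊤) {δ : ℝ} (hδ : 0 < δ) :
    ∃ (J : Finset ℕ) (F : ℕ → Set X), (∀ j, IsClosed (F j)) ∧ (⋃ j ∈ J, F j) = C ∧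
      (∀ j, F j ⊆ C) ∧ (∀ j, Metric.diam (F j) ≤ δ) ∧
      ∑ j ∈ J, Metric.diam (F j) ≤ (μH[1] C).toReal + δ := by
  set r : ENNReal := ENNReal.ofReal (δ / 2) with hr
  have hr0 : r ≠ 0 := by simp [hr, hδ]
  have hrtop : r ≠ ⊤ := ENNReal.ofReal_ne_top
  have hrr : r + r = ENNReal.ofReal δ := by
    rw [hr, ← ENNReal.ofReal_add (by positivity) (by positivity), add_halves]
  have hlt : (⨅ (t : ℕ → Set X) (_ : C ⊆ ⋃ n, t n) (_ : ∀ n, Metric.ediam (t n) ≤ r),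
      ∑' n, ⨆ _ : (t n).Nonempty, Metric.ediam (t n) ^ (1 : ℝ)) < μH[1] C + r := by
    refine lt_of_le_of_lt ?_ (ENNReal.lt_add_right hfin hr0)
    rw [Measure.hausdorffMeasure_apply]
    exact le_iSup₂_of_le r (pos_iff_ne_zero.2 hr0) le_rfl
  simp only [iInf_lt_iff] at hlt
  obtain ⟨t, hCt, htr, hsum⟩ := hlt
  have hsum' : ∑' n, Metric.ediam (t n) < μH[1] C + r := by
    refine lt_of_le_of_lt (ENNReal.tsum_le_tsum fun n => ?_) hsum
    rcases (t n).eq_empty_or_nonempty with h | h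
    · simp [h]
    · simp [h]
  obtain ⟨ε, hε, hεsum⟩ := ENNReal.exists_pos_sum_of_countable (ε := r / 2) (by simp [hr0]) ℕ
  have h2ε : ∑' n, 2 * (ε n : ENNReal) ≤ r := by
    rw [ENNReal.tsum_mul_left]
    calc 2 * ∑' n, (ε n : ENNReal) ≤ 2 * (r / 2) := by gcongr
      _ = r := ENNReal.mul_div_cancel (by simp) (by simp)
  obtain ⟨J, hJ⟩ := hC.elim_finite_subcover (fun n => Metric.thickening (ε n) (t n))
    (fun n => Metric.isOpen_thickening)
    (hCt.trans (Set.iUnion_mono fun n => Metric.self_subset_thickening (by exact_mod_cast hε n) _))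
  have hF : ∀ n, Metric.ediam (C ∩ closure (Metric.thickening (ε n) (t n))) ≤
      Metric.ediam (t n) + 2 * ε n := fun n =>
    (Metric.ediam_mono Set.inter_subset_right).trans
      ((Metric.ediam_closure _).trans_le (Metric.ediam_thickening_le _))
  have hsmall : ∀ n, Metric.ediam (C ∩ closure (Metric.thickening (ε n) (t n))) ≤
      ENNReal.ofReal δ := fun n => (hF n).trans (by
        rw [← hrr]
        exact add_le_add (htr n) ((ENNReal.le_tsum n).trans h2ε))
  refine ⟨J, fun n => C ∩ closure (Metric.thickening (ε n) (t n)),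
    fun n => hC.isClosed.inter isClosed_closure, ?_, fun n => Set.inter_subset_left, ?_, ?_⟩
  · refine Set.Subset.antisymm (Set.iUnion₂_subset fun _ _ => Set.inter_subset_left) ?_
    intro z hz
    obtain ⟨n, hn, hzn⟩ := Set.mem_iUnion₂.1 (hJ hz)
    exact Set.mem_biUnion hn ⟨hz, subset_closure hzn⟩
  · exact fun n => ENNReal.toReal_le_of_le_ofReal hδ.le (hsmall n)
  · have hb : ∑ j ∈ J, Metric.ediam (C ∩ closure (Metric.thickening (ε j) (t j))) ≤
        μH[1] C + r + r := by
      calc _ ≤ ∑ j ∈ J, (Metric.ediam (t j) + 2 * ε j) := Finset.sum_le_sum fun j _ => hF j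
        _ ≤ ∑' j, (Metric.ediam (t j) + 2 * ε j) := ENNReal.sum_le_tsum _
        _ = ∑' j, Metric.ediam (t j) + ∑' j, 2 * (ε j : ENNReal) := ENNReal.tsum_add
        _ ≤ _ := add_le_add hsum'.le h2ε
    rw [add_assoc, hrr] at hb
    have := ENNReal.toReal_mono (by finiteness) hb
    rwa [ENNReal.toReal_add hfin ENNReal.ofReal_ne_top, ENNReal.toReal_ofReal hδ.le,
      ENNReal.toReal_sum fun j _ => ((hsmall j).trans_lt ENNReal.ofReal_lt_top).ne] at this

/-- A continuum of finite length dominates, up to `ε`, a tree with a bounded number of vertices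
connecting prescribed points. -/
theorem IsConnected.exists_tree {X ι : Type} [MetricSpace X] [MeasurableSpace X]
    [BorelSpace X] [Fintype ι] [Nonempty ι] {C : Set X} (hconn : IsConnected C) (hC : IsCompact C)
    (hfin : μH[1] C ≠ ⊤) {a : ι → X} (ha : ∀ i, a i ∈ C) {ε : ℝ} (hε : 0 < ε) :
    ∃ m < 2 * Fintype.card ι, ∃ (s t : Fin m → Fin (m + 1)) (f : ι → Fin (m + 1))
      (x : Fin (m + 1) → X), EdgeConnected s t ∧ (∀ i, x (f i) = a i) ∧ (∀ v, x v ∈ C) ∧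
      ∑ e, dist (x (s e)) (x (t e)) ≤ (μH[1] C).toReal + ε := by
  classical
  have hN : (0 : ℝ) < 1 + 4 * Fintype.card ι := by positivity
  obtain ⟨δ, hδ, hδε⟩ : ∃ δ > 0, δ * (1 + 4 * Fintype.card ι) = ε :=
    ⟨ε / (1 + 4 * Fintype.card ι), by positivity, by field_simp⟩
  obtain ⟨J, F, hFc, hFC, hFsub, hFd, hFs⟩ := hC.exists_finite_closed_cover hfin hδ
  let V := {j // j ∈ J.filter fun j => (F j).Nonempty} ⊕ ι
  let U : V → Set X := Sum.elim (fun j => F j) (fun i => {a i})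
  have hUC : ⋃ v, U v = C := by
    refine Set.Subset.antisymm (Set.iUnion_subset ?_) ?_
    · rintro (j | i)
      · exact hFsub j
      · simpa [U] using ha i
    · intro z hz
      rw [← hFC] at hz
      obtain ⟨j, hj, hzj⟩ := Set.mem_iUnion₂.1 hz
      exact Set.mem_iUnion.2 ⟨.inl ⟨j, by simp [hj]; exact ⟨z, hzj⟩⟩, hzj⟩
  have hUne : ∀ v, (U v).Nonempty := by
    rintro (⟨j, hj⟩ | i)
    · exact (Finset.mem_filter.1 hj).2
    · exact Set.singleton_nonempty _
  have hUsub : ∀ v, U v ⊆ C := fun v => hUC ▸ Set.subset_iUnion U v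
  obtain ⟨E, _, s, t, hst, hcard, hint⟩ := IsPreconnected.exists_tree_of_closed_cover (F := U)
    (hUC.symm ▸ hconn.isPreconnected)
    (by rintro (j | i); exacts [hFc j, isClosed_singleton]) hUne
  choose y hy using hUne
  have hthick : IsThickTree s t U y (fun v => Metric.diam (U v))
      (fun _ => 0) :=
    { conn := hst
      card_eq := hcard
      mem := hy
      w_nonneg := fun v => Metric.diam_nonneg
      c_nonneg := fun _ => le_rfl
      dist_le := fun v p hp q hq =>
        Metric.dist_le_diam_of_mem (hC.isBounded.subset (hUsub v)) hp hq
      gap_le := fun e => by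
        obtain ⟨z, h1, h2⟩ := hint e
        exact ⟨z, h1, z, h2, by simp⟩ }
  obtain ⟨m, hm, s', t', f', x', h1, h2, h3, h4⟩ :=
    hthick.exists_tree (C := C) (a := a) (f := Sum.inr) hδ.le _ rfl (fun v => hUsub v (hy v))
      (fun i => by simpa [U] using hy (.inr i))
      (by rintro (j | i)
          · exact hFd j
          · simpa [U] using hδ.le)
  refine ⟨m, hm, s', t', f', x', h1, h2, h3, h4.trans ?_⟩
  have hsumU : ∑ v, Metric.diam (U v) ≤ (μH[1] C).toReal + δ := by
    rw [Fintype.sum_sum_type]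
    simp only [U, Sum.elim_inl, Sum.elim_inr, Metric.diam_singleton, Finset.sum_const_zero,
      add_zero]
    rw [Finset.sum_coe_sort (J.filter fun j => (F j).Nonempty) fun j => Metric.diam (F j)]
    exact (Finset.sum_le_sum_of_subset_of_nonneg (Finset.filter_subset _ _)
      fun _ _ _ => Metric.diam_nonneg).trans hFs
  simp only [Finset.sum_const_zero]
  linarith

/-- A connected set has length at least the distance between any two of its points. -/
theorem IsConnected.edist_le_hausdorffMeasure {X : Type*} [MetricSpace X] [MeasurableSpace X]
    [BorelSpace X] {K : Set X} (hK : IsConnected K) {x y : X} (hx : x ∈ K) (hy : y ∈ K) :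
    edist x y ≤ μH[1] K := by
  have hlip : LipschitzWith 1 (dist x) := LipschitzWith.dist_right x
  have hsub : Set.Icc 0 (dist x y) ⊆ dist x '' K :=
    (hK.isPreconnected.image _ hlip.continuous.continuousOn).Icc_subset
      ⟨x, hx, dist_self x⟩ ⟨y, hy, rfl⟩
  calc edist x y = μH[1] (Set.Icc 0 (dist x y)) := by
        rw [hausdorffMeasure_real, Real.volume_Icc, sub_zero, edist_dist]
    _ ≤ μH[1] (dist x '' K) := measure_mono hsub
    _ ≤ μH[1] K := by simpa using hlip.hausdorffMeasure_image_le zero_le_one K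

/-- The union of the vertices and the straight edges of a drawn graph. -/
def drawing {X V E : Type*} [NormedAddCommGroup X] [NormedSpace ℝ X] (s t : E → V) (x : V → X) :
    Set X :=
  Set.range x ∪ ⋃ e, segment ℝ (x (s e)) (x (t e))

theorem isCompact_drawing {X V E : Type*} [NormedAddCommGroup X] [NormedSpace ℝ X] [Finite V]
    [Finite E] (s t : E → V) (x : V → X) : IsCompact (drawing s t x) := by
  refine (Set.finite_range x).isCompact.union (isCompact_iUnion fun e => ?_)
  rw [segment_eq_image_lineMap]
  exact isCompact_Icc.image AffineMap.lineMap_continuous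

theorem EdgeConnected.isConnected_drawing {X V E : Type*} [NormedAddCommGroup X]
    [NormedSpace ℝ X] [Nonempty V] {s t : E → V} (h : EdgeConnected s t) (x : V → X) :
    IsConnected (drawing s t x) := by
  obtain ⟨v₀⟩ := ‹Nonempty V›
  have hmem : ∀ v, x v ∈ drawing s t x := fun v => .inl ⟨v, rfl⟩
  have hseg : ∀ e, segment ℝ (x (s e)) (x (t e)) ⊆ drawing s t x := fun e _ hz =>
    .inr (Set.mem_iUnion_of_mem e hz)
  set D := connectedComponentIn (drawing s t x) (x v₀) with hD
  have hsegD : ∀ e, ∀ p ∈ segment ℝ (x (s e)) (x (t e)), p ∈ D →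
      segment ℝ (x (s e)) (x (t e)) ⊆ D := by
    intro e p hp hpD
    rw [hD, connectedComponentIn_eq hpD]
    exact (convex_segment _ _).isPreconnected.subset_connectedComponentIn hp (hseg e)
  have hv : {v | x v ∈ D} = Set.univ := by
    refine h _ ⟨v₀, mem_connectedComponentIn (hmem v₀)⟩ fun e => ⟨fun he => ?_, fun he => ?_⟩
    · exact hsegD e _ (left_mem_segment ℝ _ _) he (right_mem_segment ℝ _ _)
    · exact hsegD e _ (right_mem_segment ℝ _ _) he (left_mem_segment ℝ _ _)
  have hsub : drawing s t x ⊆ D := by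
    refine Set.union_subset ?_ (Set.iUnion_subset fun e => ?_)
    · rintro _ ⟨v, rfl⟩
      exact hv.symm.subset (Set.mem_univ v)
    · exact hsegD e _ (left_mem_segment ℝ _ _) (hv.symm.subset (Set.mem_univ (s e)))
  refine ⟨⟨_, hmem v₀⟩, ?_⟩
  rw [hsub.antisymm (connectedComponentIn_subset _ _)]
  exact isPreconnected_connectedComponentIn

theorem hausdorffMeasure_drawing_le {X V E : Type*} [NormedAddCommGroup X] [NormedSpace ℝ X]
    [MeasurableSpace X] [BorelSpace X] [Finite V] [Fintype E] (s t : E → V) (x : V → X) :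
    μH[1] (drawing s t x) ≤ ENNReal.ofReal (∑ e, dist (x (s e)) (x (t e))) := by
  have := Measure.nullSingletonClass_hausdorff X (d := 1) one_pos
  have h0 : μH[1] (Set.range x) = 0 := (Set.finite_range x).measure_zero _
  calc μH[1] (drawing s t x) ≤ 0 + ∑ e, μH[1] (segment ℝ (x (s e)) (x (t e))) :=
        (measure_union_le _ _).trans (add_le_add h0.le (measure_iUnion_fintype_le _ _))
    _ = _ := by
        rw [zero_add, ENNReal.ofReal_sum_of_nonneg fun _ _ => dist_nonneg]
        simp only [hausdorffMeasure_segment, edist_dist]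

/-- The Steiner tree problem for finitely many points has a solution. -/
theorem exists_steiner_tree {X ι : Type} [NormedAddCommGroup X] [NormedSpace ℝ X] [ProperSpace X]
    [MeasurableSpace X] [BorelSpace X] [Finite ι] [Nonempty ι] (a : ι → X) :
    ∃ C : Set X, IsCompact C ∧ IsConnected C ∧ (∀ i, a i ∈ C) ∧
      ∀ K : Set X, IsCompact K → IsConnected K → (∀ i, a i ∈ K) → μH[1] C ≤ μH[1] K := by
  have := Fintype.ofFinite ι
  obtain ⟨i₀⟩ := id ‹Nonempty ι›
  by_cases hex : ∃ K : Set X, IsCompact K ∧ IsConnected K ∧ (∀ i, a i ∈ K) ∧ μH[1] K ≠ ⊤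
  swap
  · push Not at hex
    have hball : ∀ i, a i ∈ Metric.closedBall (a i₀) (∑ i, dist (a i) (a i₀)) := fun i =>
      Finset.single_le_sum (f := fun i => dist (a i) (a i₀)) (fun _ _ => dist_nonneg)
        (Finset.mem_univ i)
    exact ⟨_, isCompact_closedBall _ _, ⟨⟨_, hball i₀⟩, (convex_closedBall _ _).isPreconnected⟩,
      hball, fun K h1 h2 h3 => (hex K h1 h2 h3).symm ▸ le_top⟩
  obtain ⟨K₀, hK₀c, hK₀, haK₀, hK₀fin⟩ := hex
  set R := (μH[1] K₀).toReal
  have hball : ∀ K : Set X, IsConnected K → (∀ i, a i ∈ K) → μH[1] K ≤ μH[1] K₀ →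
      K ⊆ Metric.closedBall (a i₀) R := by
    intro K hK haK hle z hz
    have h1 := (hK.edist_le_hausdorffMeasure hz (haK i₀)).trans hle
    rw [Metric.mem_closedBall, dist_edist]
    exact ENNReal.toReal_mono hK₀fin h1
  let T := Σ m : Fin (2 * Fintype.card ι),
    (Fin m → Fin (m + 1)) × (Fin m → Fin (m + 1)) × (ι → Fin (m + 1))
  let Q : (τ : T) → Set (Fin (τ.1 + 1) → X) := fun τ =>
    (Set.univ.pi fun _ => Metric.closedBall (a i₀) R) ∩ {x | ∀ i, x (τ.2.2.2 i) = a i}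
  let cost : (τ : T) → (Fin (τ.1 + 1) → X) → ℝ := fun τ x =>
    ∑ e, dist (x (τ.2.1 e)) (x (τ.2.2.1 e))
  have hQ : ∀ τ, IsCompact (Q τ) := by
    intro τ
    refine (isCompact_univ_pi fun _ => isCompact_closedBall _ _).inter_right ?_
    simp only [Set.ofPred_forall]
    exact isClosed_iInter fun i => isClosed_eq (continuous_apply _) continuous_const
  have hcost : ∀ τ, Continuous (cost τ) := fun τ =>
    continuous_finsetSum _ fun e _ => (continuous_apply _).dist (continuous_apply _)
  let T' := {τ : T // EdgeConnected τ.2.1 τ.2.2.1 ∧ (Q τ).Nonempty}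
  have happrox : ∀ K : Set X, IsCompact K → IsConnected K → (∀ i, a i ∈ K) →
      μH[1] K ≤ μH[1] K₀ → ∀ ε > 0, ∃ τ : T', ∃ x ∈ Q τ.1,
        cost τ.1 x ≤ (μH[1] K).toReal + ε := by
    intro K hKc hK haK hle ε hε
    obtain ⟨m, hm, s, t, f, x, h1, h2, h3, h4⟩ :=
      hK.exists_tree hKc (hle.trans_lt hK₀fin.lt_top).ne haK hε
    have hx : x ∈ Q ⟨⟨m, hm⟩, s, t, f⟩ := ⟨fun v _ => hball K hK haK hle (h3 v), h2⟩
    exact ⟨⟨⟨⟨m, hm⟩, s, t, f⟩, h1, ⟨x, hx⟩⟩, x, hx, h4⟩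
  have hT' : Nonempty T' := (happrox K₀ hK₀c hK₀ haK₀ le_rfl 1 one_pos).nonempty
  have hmin : ∀ τ : T', ∃ x ∈ Q τ.1, IsMinOn (cost τ.1) (Q τ.1) x := fun τ =>
    (hQ τ.1).exists_isMinOn τ.2.2 (hcost τ.1).continuousOn
  choose x hxQ hxmin using hmin
  obtain ⟨τ, hτ⟩ := Finite.exists_min fun τ : T' => cost τ.1 (x τ)
  have hle : ∀ K : Set X, IsCompact K → IsConnected K → (∀ i, a i ∈ K) →
      μH[1] K ≤ μH[1] K₀ → μH[1] (drawing τ.1.2.1 τ.1.2.2.1 (x τ)) ≤ μH[1] K := by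
    intro K hKc hK haK hKle
    have hreal : cost τ.1 (x τ) ≤ (μH[1] K).toReal := by
      refine le_of_forall_pos_le_add fun ε hε => ?_
      obtain ⟨τ', y, hy, hcy⟩ := happrox K hKc hK haK hKle ε hε
      exact (hτ τ').trans ((hxmin τ' hy).trans hcy)
    exact (hausdorffMeasure_drawing_le _ _ _).trans (ENNReal.ofReal_le_of_le_toReal hreal)
  refine ⟨_, isCompact_drawing τ.1.2.1 τ.1.2.2.1 (x τ), τ.2.1.isConnected_drawing (x τ),
    fun i => .inl ⟨_, (hxQ τ).2 i⟩, fun K hKc hK haK => ?_⟩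
  rcases le_total (μH[1] K) (μH[1] K₀) with h | h
  · exact hle K hKc hK haK h
  · exact (hle K₀ hK₀c hK₀ haK₀ le_rfl).trans h

/-- There exists a minimizer of the partitioned Steiner tree problem having at most `k`
connected components. -/
theorem exists_minimizer_partitioned_steiner_with_at_most_k_components (d n k : ℕ)
    (p : Fin n → EuclideanSpace ℝ (Fin d))
    (P : Fin k → Set (EuclideanSpace ℝ (Fin d)))
    (hcover : ⋃ i, P i = Set.range p)
    (hdisj : ∀ i j : Fin k, i ≠ j → Disjoint (P i) (P j))
    (hne : ∀ i : Fin k, (P i).Nonempty) :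
    ∃ Ktilde : Set (EuclideanSpace ℝ (Fin d)),
      IsPartSteinerCompetitor p P Ktilde ∧
        (∀ K : Set (EuclideanSpace ℝ (Fin d)),
          IsPartSteinerCompetitor p P K → μH[1] Ktilde ≤ μH[1] K) ∧
        Finite (ConnectedComponents ↥Ktilde) ∧ Nat.card (ConnectedComponents ↥Ktilde) ≤ k := by
  classical
  let X := EuclideanSpace ℝ (Fin d)
  have hsteiner : ∀ B : Set (Fin n), ∃ C : Set X, B.Nonempty → IsCompact C ∧ IsConnected C ∧
      (∀ l ∈ B, p l ∈ C) ∧ ∀ K : Set X, IsCompact K → IsConnected K → (∀ l ∈ B, p l ∈ K) →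
        μH[1] C ≤ μH[1] K := by
    intro B
    by_cases hB : B.Nonempty
    · have := hB.to_subtype
      obtain ⟨C, h1, h2, h3, h4⟩ := exists_steiner_tree fun l : B => p l
      exact ⟨C, fun _ => ⟨h1, h2, fun l hl => h3 ⟨l, hl⟩,
        fun K hKc hK hpK => h4 K hKc hK fun l => hpK l l.2⟩⟩
    · exact ⟨∅, fun h => (hB h).elim⟩
  choose C hC using hsteiner
  let B : (Fin k → Fin k) → Fin k → Set (Fin n) := fun g j => {l | ∃ i, g i = j ∧ p l ∈ P i}
  have hpP : ∀ i, ∀ x ∈ P i, ∃ l, p l = x := fun i x hx =>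
    hcover.subset (Set.mem_iUnion_of_mem i hx)
  have hB : ∀ g i, (B g (g i)).Nonempty := by
    intro g i
    obtain ⟨x, hx⟩ := hne i
    obtain ⟨l, rfl⟩ := hpP i x hx
    exact ⟨l, i, rfl, hx⟩
  have : Nonempty (Fin k → Fin k) := ⟨id⟩
  obtain ⟨g, hg⟩ := Finite.exists_min fun g : Fin k → Fin k =>
    ∑ j ∈ Finset.univ.image g, μH[1] (C (B g j))
  let K₀ : Set X := ⋃ i, C (B g (g i))
  have hCK : ∀ i, C (B g (g i)) ⊆ K₀ := Set.subset_iUnion fun i => C (B g (g i))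
  have hPC : ∀ i, P i ⊆ C (B g (g i)) := by
    intro i x hx
    obtain ⟨l, rfl⟩ := hpP i x hx
    exact (hC _ (hB g i)).2.2.1 l ⟨i, rfl, hx⟩
  refine ⟨K₀, ⟨isCompact_iUnion fun i => (hC _ (hB g i)).1, ?_, ?_⟩, ?_, ?_⟩
  · rw [← hcover]
    exact Set.iUnion_mono hPC
  · intro i x hx y hy
    exact connectedComponentIn_eq
      ((hC _ (hB g i)).2.1.isPreconnected.subset_connectedComponentIn (hPC i hx) (hCK i)
        (hPC i hy))
  · rintro K ⟨hKc, hpK, hKP⟩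
    choose z hz using hne
    have hzK : ∀ i, z i ∈ K := fun i => hpK (hcover.subset (Set.mem_iUnion_of_mem i (hz i)))
    let S : Setoid (Fin k) := Setoid.ker fun i => connectedComponentIn K (z i)
    let h : Fin k → Fin k := fun i => (Quotient.mk S i).out
    have hh : ∀ i, connectedComponentIn K (z (h i)) = connectedComponentIn K (z i) := fun i =>
      Quotient.mk_out (s := S) i
    have hh' : ∀ i j, connectedComponentIn K (z i) = connectedComponentIn K (z j) → h i = h j :=
      fun i j hij => congrArg Quotient.out (Quotient.sound (s := S) hij)
    have hidem : ∀ j ∈ Finset.univ.image h, h j = j := by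
      intro j hj
      obtain ⟨i, -, rfl⟩ := Finset.mem_image.1 hj
      exact hh' _ _ (hh i)
    have hclosed : ∀ i, IsClosed (connectedComponentIn K (z i)) := by
      intro i
      rw [connectedComponentIn_eq_image (hzK i)]
      exact hKc.isClosed.isClosedEmbedding_subtypeVal.isClosedMap _ isClosed_connectedComponent
    have hdis : Set.PairwiseDisjoint (↑(Finset.univ.image h))
        fun j => connectedComponentIn K (z j) := by
      intro i hi j hj hij
      refine Set.disjoint_left.2 fun w hw1 hw2 => hij ?_
      rw [← hidem i hi, ← hidem j hj]
      exact hh' _ _ ((connectedComponentIn_eq hw1).trans (connectedComponentIn_eq hw2).symm)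
    calc μH[1] K₀ ≤ μH[1] (⋃ j ∈ Finset.univ.image g, C (B g j)) := by
          refine measure_mono (Set.iUnion_subset fun i => ?_)
          exact Set.subset_biUnion_of_mem (u := fun j => C (B g j))
            (Finset.mem_image_of_mem g (Finset.mem_univ i))
      _ ≤ ∑ j ∈ Finset.univ.image g, μH[1] (C (B g j)) := measure_biUnion_finset_le _ _
      _ ≤ ∑ j ∈ Finset.univ.image h, μH[1] (C (B h j)) := hg h
      _ ≤ ∑ j ∈ Finset.univ.image h, μH[1] (connectedComponentIn K (z j)) := by
          refine Finset.sum_le_sum fun j hj => ?_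
          obtain ⟨i, -, rfl⟩ := Finset.mem_image.1 hj
          refine (hC _ (hB h i)).2.2.2 _
            (hKc.of_isClosed_subset (hclosed _) (connectedComponentIn_subset _ _))
            (isConnected_connectedComponentIn_iff.2 (hzK _)) ?_
          rintro l ⟨i', hi', hl⟩
          rw [← hi', hh i', hKP i' _ (hz i') _ hl]
          exact mem_connectedComponentIn (hpK ⟨l, rfl⟩)
      _ = μH[1] (⋃ j ∈ Finset.univ.image h, connectedComponentIn K (z j)) :=
          (measure_biUnion_finset hdis fun j _ => (hclosed j).measurableSet).symm
      _ ≤ μH[1] K := measure_mono (Set.iUnion₂_subset fun _ _ => connectedComponentIn_subset _ _)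
  · choose z hz using hne
    let φ : Fin k → ConnectedComponents K₀ := fun i =>
      ConnectedComponents.mk ⟨z i, hCK i (hPC i (hz i))⟩
    have hφ : Function.Surjective φ := by
      intro c
      obtain ⟨⟨y, hy⟩, rfl⟩ := ConnectedComponents.surjective_coe c
      obtain ⟨i, hi⟩ := Set.mem_iUnion.1 hy
      refine ⟨i, ConnectedComponents.coe_eq_coe'.2 ?_⟩
      have hpre : IsPreconnected ((↑) ⁻¹' C (B g (g i)) : Set K₀) :=
        Topology.IsInducing.subtypeVal.isPreconnected_image.1 (by
          rw [Subtype.image_preimage_coe, Set.inter_eq_right.2 (hCK i)]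
          exact (hC _ (hB g i)).2.1.isPreconnected)
      have hzi : (⟨z i, hCK i (hPC i (hz i))⟩ : K₀) ∈ ((↑) ⁻¹' C (B g (g i)) : Set K₀) :=
        hPC i (hz i)
      exact hpre.subset_connectedComponent (x := ⟨y, hy⟩) hi hzi
    exact ⟨Finite.of_surjective φ hφ, by simpa using Nat.card_le_card_of_surjective φ hφ⟩
end

section
/- Let $\phi$ be a symmetric monotone norm on $\mathbb{R}^2$, let $\alpha\in(0,1]$ and set $p:=1/\alpha$. Then the function $t\mapsto\|t\|_{\phi,\alpha}:=\phi(\|t^+\|_{\ell^p},\|t^-\|_{\ell^p})$ is a norm on $\mathbb{R}^N$: it is nonnegative, vanishes exactly at $t=0$, is positively homogeneous, satisfies $\|-t\|_{\phi,\alpha}=\|t\|_{\phi,\alpha}$, and satisfies the triangle inequality $\|s+t\|_{\phi,\alpha}\le\|s\|_{\phi,\alpha}+\|t\|_{\phi,\alpha}$. -/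
open Finset

/-- The norm `‖t‖_{φ,α} := φ(‖t⁺‖_{ℓ^p}, ‖t⁻‖_{ℓ^p})` on `ℝ^N`, where `p = 1/α`,
`t⁺` and `t⁻` are the componentwise positive and negative parts of `t`, and
`‖·‖_{ℓ^p}` is the `ℓ^p` norm. -/
noncomputable def phiAlphaNorm (φ : ℝ × ℝ → ℝ) (p : ℝ) {N : ℕ} (t : Fin N → ℝ) : ℝ :=
  φ ((∑ ι : Fin N, (max (t ι) 0) ^ p) ^ (1 / p),
     (∑ ι : Fin N, (max (-t ι) 0) ^ p) ^ (1 / p))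

/-- Taking the `ℓ^p` norm of the positive part is subadditive for `1 ≤ p`. -/
theorem rpow_sum_posPart_add_le {ι : Type*} [Fintype ι] {p : ℝ} (hp : 1 ≤ p) (s t : ι → ℝ) :
    (∑ i, (max (s i + t i) 0) ^ p) ^ (1 / p) ≤
      (∑ i, (max (s i) 0) ^ p) ^ (1 / p) + (∑ i, (max (t i) 0) ^ p) ^ (1 / p) := by
  refine le_trans ?_ (Real.Lp_add_le_of_nonneg univ hp
    (fun i _ => le_max_right (s i) 0) (fun i _ => le_max_right (t i) 0))
  gcongr with i
  exact max_le (add_le_add (le_max_left _ _) (le_max_left _ _)) (by positivity)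

/-- Taking the `ℓ^p` norm of the positive part is positively homogeneous. -/
theorem rpow_sum_posPart_mul {ι : Type*} [Fintype ι] {p : ℝ} (hp : p ≠ 0) {c : ℝ} (hc : 0 ≤ c)
    (t : ι → ℝ) :
    (∑ i, (max (c * t i) 0) ^ p) ^ (1 / p) = c * (∑ i, (max (t i) 0) ^ p) ^ (1 / p) := by
  have h (i : ι) : (max (c * t i) 0) ^ p = c ^ p * (max (t i) 0) ^ p := by
    rw [← Real.mul_rpow hc (le_max_right _ _), mul_max_of_nonneg _ _ hc, mul_zero]
  simp_rw [h]
  rw [← mul_sum, Real.mul_rpow (by positivity) (by positivity), one_div,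
    Real.rpow_rpow_inv hc hp]

/-- The `ℓ^p` norm of the positive part vanishes only for nonpositive vectors. -/
theorem rpow_sum_posPart_eq_zero_iff {ι : Type*} [Fintype ι] {p : ℝ} (hp : p ≠ 0) (t : ι → ℝ) :
    (∑ i, (max (t i) 0) ^ p) ^ (1 / p) = 0 ↔ ∀ i, t i ≤ 0 := by
  rw [Real.rpow_eq_zero (by positivity) (one_div_ne_zero hp),
    sum_eq_zero_iff_of_nonneg fun i _ => by positivity]
  simp [Real.rpow_eq_zero (le_max_right _ _) hp]

/-- If `φ` is a symmetric monotone norm on `ℝ²` and `α ∈ (0,1]`, `p = 1/α`, then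
`‖·‖_{φ,α}` is a norm on `ℝ^N`. -/
theorem phiAlphaNorm_is_norm (N : ℕ) (φ : ℝ × ℝ → ℝ) (α : ℝ) (hα0 : 0 < α) (hα1 : α ≤ 1)
    (hφ_add : ∀ x y : ℝ × ℝ, φ (x + y) ≤ φ x + φ y)
    (hφ_smul : ∀ (c : ℝ) (x : ℝ × ℝ), φ (c • x) = |c| * φ x)
    (hφ_def : ∀ x : ℝ × ℝ, φ x = 0 ↔ x = 0)
    (hφ_sym : ∀ x y : ℝ, φ (x, y) = φ (y, x))
    (hφ_mono : ∀ x y z w : ℝ, 0 ≤ x → x ≤ z → 0 ≤ y → y ≤ w → φ (x, y) ≤ φ (z, w)) :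
    (∀ t : Fin N → ℝ, 0 ≤ phiAlphaNorm φ (1 / α) t) ∧
    (∀ t : Fin N → ℝ, phiAlphaNorm φ (1 / α) t = 0 ↔ t = 0) ∧
    (∀ c : ℝ, 0 ≤ c → ∀ t : Fin N → ℝ,
      phiAlphaNorm φ (1 / α) (c • t) = c * phiAlphaNorm φ (1 / α) t) ∧
    (∀ t : Fin N → ℝ, phiAlphaNorm φ (1 / α) (-t) = phiAlphaNorm φ (1 / α) t) ∧
    (∀ s t : Fin N → ℝ,
      phiAlphaNorm φ (1 / α) (s + t) ≤ phiAlphaNorm φ (1 / α) s + phiAlphaNorm φ (1 / α) t) := by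
  have hp : 1 ≤ 1 / α := one_le_one_div hα0 hα1
  have hp0 : 1 / α ≠ 0 := one_div_ne_zero hα0.ne'
  have hφ_nonneg (x : ℝ × ℝ) : 0 ≤ φ x := by
    have h := hφ_add x ((-1 : ℝ) • x)
    rw [hφ_smul, neg_one_smul, add_neg_cancel, (hφ_def 0).2 rfl, abs_neg, abs_one, one_mul] at h
    linarith
  refine ⟨fun t => hφ_nonneg _, fun t => ?_, fun c hc t => ?_, fun t => ?_, fun s t => ?_⟩
  · rw [phiAlphaNorm, hφ_def, Prod.mk_eq_zero, rpow_sum_posPart_eq_zero_iff hp0,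
      rpow_sum_posPart_eq_zero_iff hp0 fun i => -t i, ← forall_and, funext_iff]
    refine forall_congr' fun i => ?_
    rw [neg_nonpos, Pi.zero_apply, le_antisymm_iff]
  · simp only [phiAlphaNorm, Pi.smul_apply, smul_eq_mul, ← mul_neg]
    rw [rpow_sum_posPart_mul hp0 hc, rpow_sum_posPart_mul hp0 hc fun i => -t i]
    simpa only [Prod.smul_mk, smul_eq_mul, abs_of_nonneg hc] using hφ_smul c (_, _)
  · simp only [phiAlphaNorm, Pi.neg_apply, neg_neg]
    exact hφ_sym _ _
  · refine le_trans ?_ (hφ_add _ _)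
    simp only [phiAlphaNorm, Pi.add_apply, neg_add, Prod.mk_add_mk]
    exact hφ_mono _ _ _ _ (by positivity) (rpow_sum_posPart_add_le hp s t) (by positivity)
      (rpow_sum_posPart_add_le hp (fun i => -s i) fun i => -t i)
end

section
/- Let $\phi$ be a symmetric monotone norm on $\mathbb{R}^2$ and let $\alpha\in(0,1]$. Then the cost $\mathcal{C}:\mathbb{R}^m\to[0,\infty)$ defined by $\mathcal{C}(\theta):=\phi\big((\sum_{\theta_\iota>0}\theta_\iota)^\alpha,\,(\sum_{\theta_\iota<0}(-\theta_\iota))^\alpha\big)$ is even and subadditive: $\mathcal{C}(-\theta)=\mathcal{C}(\theta)$ for every $\theta\in\mathbb{R}^m$, and $\mathcal{C}(\theta+\theta')\le\mathcal{C}(\theta)+\mathcal{C}(\theta')$ for all $\theta,\theta'\in\mathbb{R}^m$. -/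
open Finset

/-- The multi-material cost `𝒞(θ) := φ((∑_{θ_ι > 0} θ_ι)^α, (∑_{θ_ι < 0} (-θ_ι))^α)`
associated to a norm `φ` on `ℝ²` and `α ∈ (0,1]`. -/
noncomputable def orientedCost (φ : ℝ × ℝ → ℝ) (α : ℝ) {m : ℕ} (θ : Fin m → ℝ) : ℝ :=
  φ ((∑ ι ∈ Finset.univ.filter fun ι => 0 < θ ι, θ ι) ^ α,
     (∑ ι ∈ Finset.univ.filter fun ι => θ ι < 0, -θ ι) ^ α)

theorem Finset.sum_filter_pos_add_le {ι : Type*} (s : Finset ι) (f g : ι → ℝ) :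
    ∑ i ∈ s.filter (fun i => 0 < f i + g i), (f i + g i) ≤
      ∑ i ∈ s.filter (fun i => 0 < f i), f i + ∑ i ∈ s.filter (fun i => 0 < g i), g i := by
  simp only [Finset.sum_filter, ← Finset.sum_add_distrib]
  refine Finset.sum_le_sum fun i _ => ?_
  split_ifs <;> linarith

theorem Finset.sum_filter_pos_nonneg {ι : Type*} (s : Finset ι) (f : ι → ℝ) :
    0 ≤ ∑ i ∈ s.filter (fun i => 0 < f i), f i :=
  Finset.sum_nonneg fun _ hi => (Finset.mem_filter.mp hi).2.le

theorem Finset.rpow_sum_filter_pos_add_le {ι : Type*} (s : Finset ι) (f g : ι → ℝ) {α : ℝ}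
    (hα0 : 0 ≤ α) (hα1 : α ≤ 1) :
    (∑ i ∈ s.filter (fun i => 0 < f i + g i), (f i + g i)) ^ α ≤
      (∑ i ∈ s.filter (fun i => 0 < f i), f i) ^ α +
        (∑ i ∈ s.filter (fun i => 0 < g i), g i) ^ α :=
  (Real.rpow_le_rpow (s.sum_filter_pos_nonneg fun i => f i + g i)
    (s.sum_filter_pos_add_le f g) hα0).trans <|
    Real.rpow_add_le_add_rpow (s.sum_filter_pos_nonneg f) (s.sum_filter_pos_nonneg g) hα0 hα1

theorem orientedCost_eq_pos_neg (φ : ℝ × ℝ → ℝ) (α : ℝ) {m : ℕ} (θ : Fin m → ℝ) :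
    orientedCost φ α θ =
      φ ((∑ i ∈ Finset.univ.filter fun i => 0 < θ i, θ i) ^ α,
        (∑ i ∈ Finset.univ.filter fun i => 0 < -θ i, -θ i) ^ α) := by
  simp only [orientedCost, neg_pos]

/-- The cost `𝒞` is even and subadditive. -/
theorem orientedCost_even_subadditive (m : ℕ) (φ : ℝ × ℝ → ℝ) (α : ℝ)
    (hα0 : 0 < α) (hα1 : α ≤ 1)
    (hφ_add : ∀ x y : ℝ × ℝ, φ (x + y) ≤ φ x + φ y)
    (hφ_smul : ∀ (c : ℝ) (x : ℝ × ℝ), φ (c • x) = |c| * φ x)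
    (hφ_def : ∀ x : ℝ × ℝ, φ x = 0 ↔ x = 0)
    (hφ_sym : ∀ x y : ℝ, φ (x, y) = φ (y, x))
    (hφ_mono : ∀ x y z w : ℝ, 0 ≤ x → x ≤ z → 0 ≤ y → y ≤ w → φ (x, y) ≤ φ (z, w)) :
    (∀ θ : Fin m → ℝ, orientedCost φ α (-θ) = orientedCost φ α θ) ∧
    (∀ θ θ' : Fin m → ℝ,
      orientedCost φ α (θ + θ') ≤ orientedCost φ α θ + orientedCost φ α θ') := by
  refine ⟨fun θ => ?_, fun θ θ' => ?_⟩
  · rw [orientedCost_eq_pos_neg, orientedCost_eq_pos_neg, hφ_sym]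
    simp only [Pi.neg_apply, neg_neg]
  · simp only [orientedCost_eq_pos_neg, Pi.add_apply, neg_add]
    refine le_trans (hφ_mono _ _ _ _ ?_ ?_ ?_ ?_) (hφ_add _ _)
    · exact Real.rpow_nonneg (Finset.sum_filter_pos_nonneg _ fun i => θ i + θ' i) _
    · exact Finset.rpow_sum_filter_pos_add_le _ θ θ' hα0.le hα1
    · exact Real.rpow_nonneg (Finset.sum_filter_pos_nonneg _ fun i => -θ i + -θ' i) _
    · exact Finset.rpow_sum_filter_pos_add_le _ (fun i => -θ i) (fun i => -θ' i) hα0.le hα1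
end
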